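/- Under Condition (6), for every j ∈ ℕ and every λ > 0, lim_{t→∞} (Φ_j(λt) − Φ_j(t)) / ((log t)^{jβ+j−1} (ℓ(log t))^j) = (Γ(β+1))^j / Γ(j(β+1)) · log λ. -/

import Mathlib

open Filter Topology

/-- Product weight of a box `r` in generation `j`: `p_r = p_{r 0} ⋯ p_{r (j-1)}`. -/
noncomputable def prodP (p : ℕ → ℝ) (j : ℕ) (r : Fin j → ℕ) : ℝ := ∏ i, p (r i)

/-- Counting function of generation `j`: `ρ_j(x) = #{r ∈ ℕ^j : p_r ≥ 1/x}` (as a real number). -/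
noncomputable def rhoJ (p : ℕ → ℝ) (j : ℕ) (x : ℝ) : ℝ :=
  (Nat.card {r : Fin j → ℕ // 1 / x ≤ prodP p j r} : ℝ)

/-- Expected number of occupied boxes in generation `j` of the Poissonized scheme:
`Φ_j(t) = ∑_{r ∈ ℕ^j} (1 - e^{-t p_r})`. -/
noncomputable def PhiJ (p : ℕ → ℝ) (j : ℕ) (t : ℝ) : ℝ :=
  ∑' r : Fin j → ℕ, (1 - Real.exp (-t * prodP p j r))


open MeasureTheory in
lemma rv_bdd (U : ℝ → ℝ) (hm : Measurable U) (β : ℝ) (hβ : 0 ≤ β)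
    (hpos : ∃ X0, ∀ x ≥ X0, 0 < U x)
    (hreg : ∀ c > 0, Tendsto (fun x => U (c * x) / U x) atTop (𝓝 (c ^ β))) :
    ∃ C X, ∀ x ≥ X, ∀ s ∈ Set.Icc (1/2 : ℝ) 1, U (s * x) ≤ C * U x := by
  by_contra hcon
  push Not at hcon
  obtain ⟨X0, hX0⟩ := hpos
  set δ : ℝ := (1/2 : ℝ) ^ β / 2 with hδ
  have hδpos : 0 < δ := by positivity
  have hδ1 : δ ≤ 1 / 2 := by
    have : (1/2 : ℝ) ^ β ≤ 1 := Real.rpow_le_one (by norm_num) (by norm_num) hβ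
    linarith
  choose x hx s hs hlt using fun n : ℕ => hcon (2 / δ) (max n (2 * max X0 0))
  have hxn : ∀ n : ℕ, (n : ℝ) ≤ x n := fun n => le_trans (le_max_left _ _) (hx n)
  have hxX : ∀ n : ℕ, 2 * max X0 0 ≤ x n := fun n => le_trans (le_max_right _ _) (hx n)
  have hxt : Tendsto x atTop atTop := tendsto_atTop_mono hxn tendsto_natCast_atTop_atTop
  have hsxX : ∀ n, max X0 0 ≤ s n * x n := fun n => by
    have h1 := (hs n).1
    have h2 := hxX n
    have h3 : 0 ≤ max X0 0 := le_max_right _ _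
    nlinarith
  have hU1 : ∀ n, 0 < U (x n) := fun n => hX0 _ (by
    have h3 : 0 ≤ max X0 0 := le_max_right _ _
    have h4 : X0 ≤ max X0 0 := le_max_left _ _
    have := hxX n
    show X0 ≤ x n
    linarith)
  have hU2 : ∀ n, 0 < U (s n * x n) := fun n => hX0 _ ((le_max_left _ _).trans (hsxX n))
  have hsxt : Tendsto (fun n => s n * x n) atTop atTop := by
    refine tendsto_atTop_mono (f := fun n => x n / 2) (fun n => ?_) (hxt.atTop_div_const (by norm_num))
    have h1 := (hs n).1
    have : 0 ≤ x n := le_trans (by positivity) (hxn n)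
    nlinarith
  set μ : Measure ℝ := volume.restrict (Set.Ioc 0 1)
  have key : ∀ y : ℕ → ℝ, Tendsto y atTop atTop →
      TendstoInMeasure μ (fun n u => U (u * y n) / U (y n)) atTop (fun u => u ^ β) := by
    intro y hy
    refine tendstoInMeasure_of_tendsto_ae (fun n => ?_) ?_
    · apply Measurable.aestronglyMeasurable
      exact (hm.comp (measurable_id.mul_const _)).div_const _
    · refine (ae_restrict_mem measurableSet_Ioc).mono fun u hu => ?_
      exact (hreg u hu.1).comp hy
  have hA := tendstoInMeasure_iff_dist.1 (key x hxt) δ hδpos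
  have hB := tendstoInMeasure_iff_dist.1 (key _ hsxt) δ hδpos
  have h16 : (0 : ENNReal) < ENNReal.ofReal (1/16) := by simp
  obtain ⟨n, hAn, hBn⟩ := ((hA.eventually_lt_const h16).and (hB.eventually_lt_const h16)).exists
  set A := {u : ℝ | δ ≤ dist (U (u * x n) / U (x n)) (u ^ β)}
  set B := {u : ℝ | δ ≤ dist (U (u * (s n * x n)) / U (s n * x n)) (u ^ β)}
  rw [Measure.restrict_apply' measurableSet_Ioc] at hAn hBn
  have hsn := hs n
  have hs0 : 0 < s n := by linarith [hsn.1]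
  have hsub : Set.Icc (1/2 : ℝ) 1 ⊆ (B ∩ Set.Ioc 0 1) ∪ (s n * ·) ⁻¹' (A ∩ Set.Ioc 0 1) := by
    intro u hu
    have hu0 : 0 < u := by linarith [hu.1]
    by_cases huB : u ∈ B
    · exact Or.inl ⟨huB, hu0, hu.2⟩
    · right
      have hle1 : s n * u ≤ 1 := by nlinarith [hsn.2, hu.2]
      refine ⟨?_, by positivity, hle1⟩
      have h1 : dist (U (u * (s n * x n)) / U (s n * x n)) (u ^ β) < δ := not_le.1 huB
      have h2 : (1/2 : ℝ) ^ β ≤ u ^ β := Real.rpow_le_rpow (by norm_num) hu.1 hβ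
      rw [Real.dist_eq, abs_lt] at h1
      have h3 : δ < U (u * (s n * x n)) / U (s n * x n) := by linarith [h1.1]
      rw [lt_div_iff₀ (hU2 n)] at h3
      have h4 := hlt n
      have h5 : 2 * U (x n) < U (u * (s n * x n)) := by
        have : δ * (2 / δ * U (x n)) = 2 * U (x n) := by field_simp
        nlinarith
      show δ ≤ dist (U (s n * u * x n) / U (x n)) ((s n * u) ^ β)
      have h6 : s n * u * x n = u * (s n * x n) := by ring
      have h7 : (s n * u) ^ β ≤ 1 := Real.rpow_le_one (by positivity) hle1 hβ
      rw [h6, Real.dist_eq]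
      have h8 : 2 < U (u * (s n * x n)) / U (x n) := by
        rw [lt_div_iff₀ (hU1 n)]; exact h5
      refine le_trans ?_ (le_abs_self _)
      linarith
  have hvol := (measure_mono (μ := volume) hsub).trans (measure_union_le _ _)
  rw [Real.volume_preimage_mul_left hs0.ne', Real.volume_Icc] at hvol
  have h2 : ENNReal.ofReal |(s n)⁻¹| ≤ ENNReal.ofReal 2 := by
    apply ENNReal.ofReal_le_ofReal
    rw [abs_of_pos (by positivity), inv_le_comm₀ hs0 (by norm_num)]
    linarith [hsn.1]
  have h3 := hvol.trans (add_le_add hBn.le (mul_le_mul' h2 hAn.le))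
  rw [← ENNReal.ofReal_mul (by norm_num), ← ENNReal.ofReal_add (by norm_num) (by norm_num),
    ENNReal.ofReal_le_ofReal_iff (by norm_num)] at h3
  norm_num at h3

lemma rec_lim (e ε : ℝ → ℝ) (q : ℝ) (hq0 : 0 ≤ q) (hq : q < 1) (he : ∀ x, 0 ≤ e x)
    (hε : Tendsto ε atTop (𝓝 0)) (h : ∀ᶠ x in atTop, e x ≤ ε x + q * e (x / 2))
    (hb : ∀ᶠ X in atTop, ∃ M, ∀ x ∈ Set.Icc X (2 * X), e x ≤ M) :
    Tendsto e atTop (𝓝 0) := by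
  -- step 1 : eventual boundedness
  have h1 : ∃ M > 0, ∀ᶠ x in atTop, e x ≤ M := by
    have hε1 : ∀ᶠ x in atTop, ε x < 1 - q := hε.eventually_lt_const (by linarith)
    obtain ⟨X1, hX1⟩ := eventually_atTop.1 (h.and hε1)
    obtain ⟨X, ⟨M, hM⟩, hXX1, hX0⟩ := (hb.and ((eventually_ge_atTop X1).and
      (eventually_gt_atTop 0))).exists
    have hmain : ∀ n : ℕ, ∀ x, X ≤ x → x ≤ 2 ^ (n + 1) * X → e x ≤ max M 1 := by
      intro n
      induction n with
      | zero => intro x hx hx2; exact (hM x ⟨hx, by simpa using hx2⟩).trans (le_max_left _ _)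
      | succ n ih =>
        intro x hx hx2
        by_cases hc : x ≤ 2 * X
        · exact (hM x ⟨hx, hc⟩).trans (le_max_left _ _)
        · push Not at hc
          have h2 := hX1 x (hXX1.trans hx)
          have h3 := ih (x / 2) (by linarith) (by rw [pow_succ] at hx2; linarith)
          have h4 : (1 : ℝ) ≤ max M 1 := le_max_right _ _
          nlinarith [h2.1, h2.2]
    refine ⟨max M 1, by positivity, (eventually_ge_atTop X).mono fun x hx => ?_⟩
    obtain ⟨n, hn⟩ := pow_unbounded_of_one_lt (x / X) (one_lt_two)
    refine hmain n x hx ?_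
    rw [div_lt_iff₀ hX0] at hn
    rw [pow_succ]
    nlinarith [mul_pos (pow_pos (two_pos (α := ℝ)) n) hX0]
  obtain ⟨M, hM0, hM⟩ := h1
  set q' := (1 + q) / 2 with hq'
  have h2 : ∀ n : ℕ, ∀ᶠ x in atTop, e x ≤ q' ^ n * M := by
    intro n
    induction n with
    | zero => simpa using hM
    | succ n ih =>
      have hMn : 0 < q' ^ n * M := by positivity
      have hε1 : ∀ᶠ x in atTop, ε x < (1 - q) / 2 * (q' ^ n * M) :=
        hε.eventually_lt_const (mul_pos (by linarith) hMn)
      have ih2 := (tendsto_id.atTop_div_const (two_pos (α := ℝ))).eventually ih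
      filter_upwards [h, hε1, ih2] with x hx1 hx2 hx3
      simp only [id] at hx3
      rw [pow_succ]
      have : q' ^ n * q' * M = q' * (q' ^ n * M) := by ring
      rw [this, hq']
      nlinarith
  have h3 : Tendsto (fun n : ℕ => q' ^ n * M) atTop (𝓝 0) := by
    have := (tendsto_pow_atTop_nhds_zero_of_lt_one (r := q') (by linarith) (by linarith)).mul_const M
    simpa using this
  rw [Metric.tendsto_nhds]
  intro δ hδ
  obtain ⟨n, hn⟩ := (h3.eventually_lt_const hδ).exists
  filter_upwards [h2 n] with x hx
  rw [Real.dist_eq, sub_zero, abs_of_nonneg (he x)]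
  linarith

open intervalIntegral in
lemma karamata (N : ℝ → ℝ) (hN : Monotone N) (β : ℝ) (hβ : 0 ≤ β) (hN0 : ∀ x, 0 ≤ N x)
    (hU1 : ∀ᶠ x in atTop, 1 ≤ N (x + 1) - N x)
    (hreg : ∀ c > 0, Tendsto (fun x => (N (c * x + 1) - N (c * x)) / (N (x + 1) - N x)) atTop
      (𝓝 (c ^ β))) :
    Tendsto (fun x => N x / (x * (N (x + 1) - N x))) atTop (𝓝 (1 / (β + 1))) := by
  set U : ℝ → ℝ := fun x => N (x + 1) - N x with hU
  have hNm : Measurable N := hN.measurable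
  have hUm : Measurable U := (hNm.comp (measurable_id.add_const 1)).sub hNm
  have hUnn : ∀ x, 0 ≤ U x := fun x => sub_nonneg.2 (hN (by linarith))
  obtain ⟨X0, hX0⟩ := eventually_atTop.1 hU1
  obtain ⟨C, X, hC⟩ := rv_bdd U hUm β hβ ⟨X0, fun x hx => lt_of_lt_of_le one_pos (hX0 x hx)⟩ hreg
  have hNi : ∀ a b, IntervalIntegrable N MeasureTheory.volume a b :=
    fun a b => (hN.monotoneOn _).intervalIntegrable
  set S : ℝ → ℝ := fun y => ∫ t in y..(y + 1), N t with hS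
  have hS1 : ∀ y, N y ≤ S y ∧ S y ≤ N (y + 1) := by
    intro y
    constructor
    · have := integral_mono_on (a := y) (b := y + 1) (f := fun _ => N y) (g := N) (by linarith)
        (by simp) (hNi _ _) (fun t ht => hN ht.1)
      simpa using this
    · have := integral_mono_on (a := y) (b := y + 1) (f := N) (g := fun _ => N (y + 1)) (by linarith)
        (hNi _ _) (by simp) (fun t ht => hN ht.2)
      simpa using this
  -- step A
  have hA : Tendsto (fun x => ∫ s in (1/2 : ℝ)..1, U (s * x) / U x) atTop
      (𝓝 (∫ s in (1/2 : ℝ)..1, s ^ β)) := by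
    refine tendsto_integral_filter_of_dominated_convergence (fun _ => C) ?_ ?_ ?_ ?_
    · exact Eventually.of_forall fun x => ((hUm.comp (measurable_id.mul_const _)).div_const _).aestronglyMeasurable
    · filter_upwards [eventually_ge_atTop X, eventually_ge_atTop X0] with x hx hx0
      refine Eventually.of_forall fun s hs => ?_
      rw [Set.uIoc_of_le (by norm_num)] at hs
      have h1 : 0 < U x := lt_of_lt_of_le one_pos (hX0 x hx0)
      rw [Real.norm_of_nonneg (div_nonneg (hUnn _) (hUnn _)), div_le_iff₀ h1]
      exact hC x hx s ⟨hs.1.le, hs.2⟩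
    · simp
    · refine Eventually.of_forall fun s hs => ?_
      rw [Set.uIoc_of_le (by norm_num)] at hs
      exact hreg s (by linarith [hs.1])
  have hval : (∫ s in (1/2 : ℝ)..1, s ^ β) = (1 - (1/2 : ℝ) ^ (β + 1)) / (β + 1) := by
    rw [integral_rpow (Or.inl (by linarith))]; simp
  rw [hval] at hA
  -- step B
  have hB : ∀ x > 0, ∫ s in (1/2 : ℝ)..1, U (s * x) / U x = (S x - S (x / 2)) / (x * U x) := by
    intro x hx
    rw [intervalIntegral.integral_div, integral_comp_mul_right U hx.ne']
    have e1 : ∫ t in (1 / 2 * x)..(1 * x), U t = S x - S (x / 2) := by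
      simp only [hU]
      rw [integral_sub (by
        have := (hNi (1 / 2 * x + 1) (1 * x + 1)).comp_add_right 1
        simpa using this) (hNi _ _), integral_comp_add_right]
      rw [hS]
      simp only []
      rw [integral_interval_sub_interval_comm (hNi _ _) (hNi _ _) (hNi _ _)]
      rw [integral_symm (1 / 2 * x), integral_symm (1 * x)]
      have : 1 / 2 * x = x / 2 := by ring
      rw [this, one_mul]
      ring
    rw [e1, smul_eq_mul]
    field_simp
  set b := β + 1 with hb
  have hbpos : 0 < b := by linarith
  set r : ℝ := (1/2 : ℝ) ^ b with hr
  have hr1 : r < 1 := Real.rpow_lt_one (by norm_num) (by norm_num) hbpos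
  have hr0 : 0 < r := by positivity
  -- half ratio
  have hhalf : Tendsto (fun x => U (x / 2) / U x) atTop (𝓝 ((1/2 : ℝ) ^ β)) := by
    refine (hreg (1/2) (by norm_num)).congr fun x => ?_
    have : 1 / 2 * x = x / 2 := by ring
    simp only [hU, this]
  have hinv : Tendsto (fun x : ℝ => 1 / x) atTop (𝓝 0) := by
    simpa using tendsto_inv_atTop_zero (𝕜 := ℝ)
  -- step C
  have hCc : Tendsto (fun x => (N x - N (x / 2)) / (x * U x)) atTop (𝓝 ((1 - r) / b)) := by
    have herr : Tendsto (fun x => (N x - N (x / 2)) / (x * U x) -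
        ∫ s in (1/2 : ℝ)..1, U (s * x) / U x) atTop (𝓝 0) := by
      have hbd : Tendsto (fun x => 1 / x * (1 + U (x / 2) / U x)) atTop (𝓝 0) := by
        simpa using hinv.mul (hhalf.const_add 1)
      refine squeeze_zero_norm' ?_ hbd
      filter_upwards [eventually_gt_atTop 0, eventually_ge_atTop X0] with x hx hx0
      have h1 : 0 < U x := lt_of_lt_of_le one_pos (hX0 x hx0)
      rw [hB x hx, ← sub_div, norm_div, Real.norm_eq_abs, Real.norm_of_nonneg (by positivity)]
      have : 1 / x * (1 + U (x / 2) / U x) = (U x + U (x / 2)) / (x * U x) := by field_simp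
      rw [this]
      gcongr
      have a1 := hS1 x
      have a2 := hS1 (x / 2)
      have a3 : U x = N (x + 1) - N x := rfl
      have a4 : U (x / 2) = N (x / 2 + 1) - N (x / 2) := rfl
      rw [abs_le]
      constructor <;> linarith [hUnn x, hUnn (x/2)]
    simpa using herr.add hA
  -- recursion
  set R : ℝ → ℝ := fun x => N x / (x * U x) with hR
  have hq : Tendsto (fun x => U (x / 2) / U x / 2) atTop (𝓝 r) := by
    have := hhalf.div_const 2
    have e : r = (1/2 : ℝ) ^ β / 2 := by
      rw [hr, hb, Real.rpow_add (by norm_num), Real.rpow_one]; ring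
    rw [e]; exact this
  have hrec : ∀ᶠ x in atTop, R x - 1 / b = ((N x - N (x / 2)) / (x * U x)
      + (U (x / 2) / U x / 2 - 1) * (1 / b)) + U (x / 2) / U x / 2 * (R (x / 2) - 1 / b) := by
    filter_upwards [eventually_gt_atTop 0, eventually_ge_atTop X0,
      eventually_ge_atTop (2 * X0)] with x hx hx0 hx1
    have h1 : 0 < U x := lt_of_lt_of_le one_pos (hX0 x hx0)
    have h2 : 0 < U (x / 2) := lt_of_lt_of_le one_pos (hX0 _ (by show X0 ≤ x / 2; linarith))
    simp only [hR]
    field_simp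
    ring
  have hε : Tendsto (fun x => |(N x - N (x / 2)) / (x * U x)
      + (U (x / 2) / U x / 2 - 1) * (1 / b)|) atTop (𝓝 0) := by
    have := (hCc.add ((hq.sub_const 1).mul_const (1 / b))).abs
    have e : |(1 - r) / b + (r - 1) * (1 / b)| = 0 := by
      rw [abs_eq_zero]; ring
    rwa [e] at this
  have hfin := rec_lim (fun x => |R x - 1 / b|) _ ((1 + r) / 2) (by linarith) (by linarith)
    (fun x => abs_nonneg _) hε ?_ ?_
  · rw [tendsto_iff_dist_tendsto_zero]
    simpa only [Real.dist_eq] using hfin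
  · filter_upwards [hrec, hq.eventually_le_const (show r < (1 + r) / 2 by linarith)] with x hx hx2
    rw [hx]
    refine (abs_add_le _ _).trans (add_le_add le_rfl ?_)
    rw [abs_mul, abs_of_nonneg (div_nonneg (div_nonneg (hUnn _) (hUnn _)) zero_le_two)]
    exact mul_le_mul_of_nonneg_right hx2 (abs_nonneg _)
  · filter_upwards [eventually_ge_atTop 1, eventually_ge_atTop X0] with Y hY hY0
    refine ⟨N (2 * Y) + 1 / b, fun x hx => ?_⟩
    have h1 : 1 ≤ U x := hX0 x (hY0.trans hx.1)
    have h3 : 1 ≤ x := hY.trans hx.1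
    have h2 : R x ≤ N (2 * Y) := by
      simp only [hR]
      rw [div_le_iff₀ (by positivity)]
      have := hN hx.2
      nlinarith [hN0 (2 * Y), mul_le_mul h3 h1 zero_le_one (by linarith)]
    have h4 : 0 ≤ R x := div_nonneg (hN0 _) (mul_nonneg (by linarith) (by linarith))
    have h5 : 0 < 1 / b := by positivity
    rw [abs_le]
    constructor <;> linarith [hN0 (2 * Y)]

lemma N_reg (N : ℝ → ℝ) (β : ℝ)
    (hU1 : ∀ᶠ x in atTop, 1 ≤ N (x + 1) - N x) (hβ : 0 ≤ β)
    (hreg : ∀ c > 0, Tendsto (fun x => (N (c * x + 1) - N (c * x)) / (N (x + 1) - N x)) atTop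
      (𝓝 (c ^ β)))
    (hK : Tendsto (fun x => N x / (x * (N (x + 1) - N x))) atTop (𝓝 (1 / (β + 1))))
    (c : ℝ) (hc : 0 < c) :
    Tendsto (fun x => N (c * x) / N x) atTop (𝓝 (c ^ (β + 1))) := by
  have hb : 0 < β + 1 := by linarith
  have hcx : Tendsto (fun x : ℝ => c * x) atTop atTop := tendsto_id.const_mul_atTop hc
  have h1 := hK.comp hcx
  have h2 := (h1.div hK (by positivity)).mul ((hreg c hc).const_mul c)
  have e : 1 / (β + 1) / (1 / (β + 1)) * (c * c ^ β) = c ^ (β + 1) := by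
    rw [Real.rpow_add hc, Real.rpow_one]; field_simp
  rw [e] at h2
  refine h2.congr' ?_
  filter_upwards [eventually_gt_atTop 0, hU1, hcx.eventually hU1] with x hx hx1 hx2
  simp only [Function.comp, Pi.div_apply]
  have a1 : N (x + 1) - N x ≠ 0 := by linarith
  have a2 : N (c * x + 1) - N (c * x) ≠ 0 := by linarith
  by_cases hN : N x = 0
  · simp [hN]
  field_simp

lemma N_cont (N : ℝ → ℝ) (hN : Monotone N) (b : ℝ) (hpos : ∀ᶠ x in atTop, 0 < N x)
    (hreg : ∀ c > 0, Tendsto (fun x => N (c * x) / N x) atTop (𝓝 (c ^ b)))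
    (s : ℝ) (hs : 0 < s) :
    Tendsto (fun z : ℝ × ℝ => N (z.2 * z.1) / N z.1) (atTop ×ˢ 𝓝 s) (𝓝 (s ^ b)) := by
  have hcont : ContinuousAt (fun u : ℝ => u ^ b) s := Real.continuousAt_rpow_const _ _ (Or.inl hs.ne')
  rw [tendsto_order]
  have hx0 : ∀ᶠ z : ℝ × ℝ in atTop ×ˢ 𝓝 s, 0 < z.1 ∧ 0 < N z.1 :=
    tendsto_fst.eventually ((eventually_gt_atTop 0).and hpos)
  constructor
  · intro a ha
    have h1 : ∀ᶠ u in 𝓝 s, a < u ^ b := hcont.eventually (lt_mem_nhds ha)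
    have h2 : ∀ᶠ u in 𝓝 s, 0 < u := lt_mem_nhds hs
    obtain ⟨u, ⟨hu1, hu2⟩, hus⟩ := (((h1.and h2).filter_mono nhdsWithin_le_nhds).and
      (self_mem_nhdsWithin : Set.Iio s ∈ 𝓝[<] s)).exists
    have h3 : ∀ᶠ z : ℝ × ℝ in atTop ×ˢ 𝓝 s, a < N (u * z.1) / N z.1 :=
      tendsto_fst.eventually ((hreg u hu2).eventually_const_lt hu1)
    have h4 : ∀ᶠ z : ℝ × ℝ in atTop ×ˢ 𝓝 s, u < z.2 :=
      tendsto_snd.eventually (lt_mem_nhds hus)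
    filter_upwards [h3, h4, hx0] with z hz1 hz2 hz3
    refine hz1.trans_le ?_
    have := hz3.2
    gcongr
    exact hN (mul_le_mul_of_nonneg_right hz2.le hz3.1.le)
  · intro a ha
    have h1 : ∀ᶠ u in 𝓝 s, u ^ b < a := hcont.eventually (gt_mem_nhds ha)
    have h2 : ∀ᶠ u in 𝓝 s, 0 < u := lt_mem_nhds hs
    obtain ⟨u, ⟨hu1, hu2⟩, hus⟩ := (((h1.and h2).filter_mono nhdsWithin_le_nhds).and
      (self_mem_nhdsWithin : Set.Ioi s ∈ 𝓝[>] s)).exists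
    have h3 : ∀ᶠ z : ℝ × ℝ in atTop ×ˢ 𝓝 s, N (u * z.1) / N z.1 < a :=
      tendsto_fst.eventually ((hreg u hu2).eventually_lt_const hu1)
    have h4 : ∀ᶠ z : ℝ × ℝ in atTop ×ˢ 𝓝 s, z.2 < u :=
      tendsto_snd.eventually (gt_mem_nhds hus)
    filter_upwards [h3, h4, hx0] with z hz1 hz2 hz3
    refine lt_of_le_of_lt ?_ hz1
    have := hz3.2
    gcongr
    exact hN (mul_le_mul_of_nonneg_right hz2.le hz3.1.le)

/-- `N x / x` is almost increasing, case of positive index. -/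
lemma N_almost (N : ℝ → ℝ) (hN : Monotone N) (β : ℝ) (hβ : 0 < β) (hpos : ∀ᶠ x in atTop, 0 < N x)
    (hreg : ∀ c > 0, Tendsto (fun x => N (c * x) / N x) atTop (𝓝 (c ^ (β + 1)))) :
    ∃ X > 0, ∀ y x, X ≤ y → y ≤ x → N y / y ≤ 2 * (N x / x) := by
  have h2 := (hreg (1/2) (by norm_num)).eventually_lt_const (show (1/2 : ℝ) ^ (β + 1) < 1 / 2 by
    calc (1/2 : ℝ) ^ (β + 1) < (1/2 : ℝ) ^ (1 : ℝ) :=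
          Real.rpow_lt_rpow_of_exponent_gt (by norm_num) (by norm_num) (by linarith)
      _ = 1 / 2 := by simp)
  obtain ⟨X, hX⟩ := eventually_atTop.1 (h2.and (hpos.and (eventually_gt_atTop 0)))
  have hX0 : 0 < X := (hX X le_rfl).2.2
  refine ⟨X, hX0, ?_⟩
  have hmain : ∀ n : ℕ, ∀ y x, X ≤ y → y ≤ x → x ≤ 2 ^ n * y → N y / y ≤ 2 * (N x / x) := by
    intro n
    induction n with
    | zero =>
      intro y x hy hyx hx
      have : x = y := le_antisymm (by simpa using hx) hyx
      subst this
      have := hX x hy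
      have : 0 < N x / x := div_pos this.2.1 this.2.2
      linarith
    | succ n ih =>
      intro y x hy hyx hx
      have hxx := hX x (hy.trans hyx)
      have hy0 : 0 < y := (hX y hy).2.2
      by_cases hc : x ≤ 2 * y
      · have h1 : N y ≤ N x := hN hyx
        rw [div_le_iff₀ hy0]
        have : N x / x * x = N x := div_mul_cancel₀ _ hxx.2.2.ne'
        have h3 : 0 < N x / x := div_pos hxx.2.1 hxx.2.2
        nlinarith
      · push Not at hc
        have h1 := ih y (x / 2) hy (by linarith) (by rw [pow_succ] at hx; linarith)
        refine h1.trans ?_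
        have h3 := hxx.1
        rw [div_lt_iff₀ hxx.2.1] at h3
        have e : 1 / 2 * x = x / 2 := by ring
        rw [e] at h3
        have : N (x / 2) / (x / 2) ≤ N x / x := by
          have hx0 := hxx.2.2
          rw [div_le_div_iff₀ (by positivity) hx0]
          nlinarith
        linarith
  intro y x hy hyx
  have hy0 : 0 < y := (hX y hy).2.2
  obtain ⟨n, hn⟩ := pow_unbounded_of_one_lt (x / y) (one_lt_two)
  rw [div_lt_iff₀ hy0] at hn
  exact hmain n y x hy hyx hn.le

/-- exponential growth control of unit increments -/
lemma growth (N : ℝ → ℝ) (hN : Monotone N) (hN0 : ∀ x, 0 ≤ N x) (h : ℝ)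
    (hU1 : ∀ᶠ x in atTop, 1 ≤ N (x + 1) - N x)
    (hsh : Tendsto (fun x => (N (x + 1 + 1) - N (x + 1)) / (N (x + 1) - N x)) atTop (𝓝 1))
    (hh : ∃ C, ∀ᶠ x in atTop, N (x + h) - N x ≤ C * (N (x + 1) - N x)) :
    ∃ C X, 0 ≤ C ∧ ∀ x ≥ X, ∀ y, N (y + h) - N y ≤ C * Real.exp (|x - y| / 2) * (N (x + 1) - N x) := by
  set U : ℝ → ℝ := fun x => N (x + 1) - N x with hU
  set q := Real.exp (1 / 2) with hq
  have hq1 : 1 < q := Real.one_lt_exp_iff.2 (by norm_num)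
  obtain ⟨C, hC⟩ := hh
  have hq2 : q⁻¹ < 1 := inv_lt_one_of_one_lt₀ hq1
  obtain ⟨X, hX⟩ := eventually_atTop.1 (hU1.and ((hsh.eventually_lt_const hq1).and
    ((hsh.eventually_const_lt hq2).and hC)))
  have f1 : ∀ x ≥ X, 1 ≤ U x := fun x hx => (hX x hx).1
  have f2 : ∀ x ≥ X, U (x + 1) ≤ q * U x := fun x hx => by
    have := (hX x hx).2.1
    rw [div_lt_iff₀ (by linarith [(hX x hx).1])] at this
    exact this.le
  have f3 : ∀ x ≥ X, U x ≤ q * U (x + 1) := fun x hx => by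
    have := (hX x hx).2.2.1
    rw [lt_div_iff₀ (by linarith [(hX x hx).1]), inv_mul_lt_iff₀ (by linarith)] at this
    exact this.le
  have f4 : ∀ x ≥ X, N (x + h) - N x ≤ C * U x := fun x hx => (hX x hx).2.2.2
  have hUnn : ∀ x, 0 ≤ U x := fun x => sub_nonneg.2 (hN (by linarith))
  have hqle : q ≤ 2 := by
    have := Real.exp_one_lt_d9
    have h2 : q * q = Real.exp 1 := by rw [hq, ← Real.exp_add]; norm_num
    nlinarith
  -- within unit distance
  have g1 : ∀ x ≥ X, ∀ s, 0 ≤ s → s ≤ 1 → U (x + s) ≤ 3 * U x := by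
    intro x hx s hs0 hs1
    have a1 : N (x + s + 1) ≤ N (x + 1 + 1) := hN (by linarith)
    have a2 : N x ≤ N (x + s) := hN (by linarith)
    have a3 := f2 x hx
    have a4 := hUnn x
    have : U (x + s) ≤ U x + U (x + 1) := by simp only [hU]; linarith
    nlinarith
  have g2 : ∀ x ≥ X, ∀ s, 0 ≤ s → s ≤ 1 → U x ≤ 6 * U (x + s) := by
    intro x hx s hs0 hs1
    have a1 : N (x + 1 + 1) ≤ N (x + s + 1 + 1) := hN (by linarith)
    have a2 : N (x + s) ≤ N (x + 1) := hN (by linarith)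
    have a3 := f2 (x + s) (by show X ≤ x + s; linarith [show X ≤ x from hx])
    have a5 := f3 x hx
    have a4 := hUnn (x + s)
    have : U (x + 1) ≤ U (x + s) + U (x + s + 1) := by simp only [hU]; linarith
    nlinarith [hUnn (x + 1)]
  -- integer steps
  have k1 : ∀ n : ℕ, ∀ x ≥ X, U (x + n) ≤ q ^ n * U x := by
    intro n
    induction n with
    | zero => intro x hx; simp
    | succ n ih =>
      intro x hx
      have h1 := f2 (x + n) (by
        have : (0 : ℝ) ≤ n := by positivity
        show X ≤ x + n; linarith [show X ≤ x from hx])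
      have h2 := ih x hx
      push_cast
      rw [← add_assoc, pow_succ]
      nlinarith
  have k2 : ∀ n : ℕ, ∀ x ≥ X, U x ≤ q ^ n * U (x + n) := by
    intro n
    induction n with
    | zero => intro x hx; simp
    | succ n ih =>
      intro x hx
      have h1 := f3 (x + n) (by
        have : (0 : ℝ) ≤ n := by positivity
        show X ≤ x + n; linarith [show X ≤ x from hx])
      have h2 := ih x hx
      push_cast
      rw [← add_assoc, pow_succ]
      have : 0 < q ^ n := by positivity
      nlinarith
  have hpow : ∀ a : ℝ, 0 ≤ a → q ^ ⌊a⌋₊ ≤ Real.exp (a / 2) := by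
    intro a ha
    rw [hq, ← Real.exp_nat_mul]
    apply Real.exp_le_exp.2
    have := Nat.floor_le ha
    linarith
  have m1 : ∀ x ≥ X, ∀ y ≥ X, U y ≤ 6 * Real.exp (|x - y| / 2) * U x := by
    intro x hx y hy
    rcases le_total x y with hxy | hxy
    · set a := y - x with ha
      have ha0 : 0 ≤ a := by linarith
      have b1 := Nat.floor_le ha0
      have b2 := Nat.lt_floor_add_one a
      have hx' : X ≤ x + (⌊a⌋₊ : ℝ) := by
        have : (0 : ℝ) ≤ ⌊a⌋₊ := by positivity
        linarith [show X ≤ x from hx]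
      have c1 := g1 (x + (⌊a⌋₊ : ℝ)) hx' (a - ⌊a⌋₊) (by linarith) (by linarith)
      have e : x + (⌊a⌋₊ : ℝ) + (a - ⌊a⌋₊) = y := by rw [ha]; ring
      rw [e] at c1
      have c2 := k1 ⌊a⌋₊ x hx
      have c3 := hpow a ha0
      have e2 : |x - y| = a := by rw [abs_sub_comm, abs_of_nonneg ha0]
      rw [e2]
      have c4 : q ^ ⌊a⌋₊ * U x ≤ Real.exp (a / 2) * U x := mul_le_mul_of_nonneg_right c3 (hUnn x)
      have : 0 ≤ Real.exp (a / 2) * U x := mul_nonneg (Real.exp_pos _).le (hUnn x)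
      linarith
    · set a := x - y with ha
      have ha0 : 0 ≤ a := by linarith
      have b1 := Nat.floor_le ha0
      have b2 := Nat.lt_floor_add_one a
      have hx' : X ≤ y + (⌊a⌋₊ : ℝ) := by
        have : (0 : ℝ) ≤ ⌊a⌋₊ := by positivity
        linarith [show X ≤ y from hy]
      have c1 := g2 (y + (⌊a⌋₊ : ℝ)) hx' (a - ⌊a⌋₊) (by linarith) (by linarith)
      have e : y + (⌊a⌋₊ : ℝ) + (a - ⌊a⌋₊) = x := by rw [ha]; ring
      rw [e] at c1
      have c2 := k2 ⌊a⌋₊ y hy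
      have c3 := hpow a ha0
      have e2 : |a| = a := abs_of_nonneg ha0
      rw [e2]
      have hqp : 0 < q ^ ⌊a⌋₊ := by positivity
      have c5 : q ^ ⌊a⌋₊ * U (y + (⌊a⌋₊ : ℝ)) ≤ q ^ ⌊a⌋₊ * (6 * U x) :=
        mul_le_mul_of_nonneg_left c1 hqp.le
      have c4 : q ^ ⌊a⌋₊ * U x ≤ Real.exp (a / 2) * U x := mul_le_mul_of_nonneg_right c3 (hUnn x)
      linarith
  refine ⟨6 * max C 0 + N (X + h), X, by have := hN0 (X + h); positivity, ?_⟩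
  intro x hx y
  have hE : 1 ≤ Real.exp (|x - y| / 2) := Real.one_le_exp (by positivity)
  have hUx := f1 x hx
  show _ ≤ _ * U x
  have hNX := hN0 (X + h)
  have hC0 : 0 ≤ max C 0 := le_max_right _ _
  have hEU : 1 ≤ Real.exp (|x - y| / 2) * U x := by nlinarith
  by_cases hy : X ≤ y
  · have h1 := f4 y hy
    have h2 := m1 x hx y hy
    have h3 : C * U y ≤ max C 0 * U y := mul_le_mul_of_nonneg_right (le_max_left _ _) (hUnn y)
    have h4 := mul_le_mul_of_nonneg_left h2 hC0
    have h5 := mul_nonneg hNX (zero_le_one.trans hEU)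
    nlinarith
  · push Not at hy
    have h1 : N (y + h) ≤ N (X + h) := hN (by linarith)
    have h2 := hN0 y
    have h3 := mul_le_mul_of_nonneg_left hEU hNX
    have h5 := mul_nonneg hC0 (zero_le_one.trans hEU)
    nlinarith

/-- Boxes of the first generation of weight at least `exp (-y)`. -/
def AA (p : ℕ → ℝ) (y : ℝ) : Set ℕ := {k | Real.exp (-y) ≤ p k}

/-- Number of first-generation boxes of weight at least `exp (-y)`. -/
noncomputable def NN (p : ℕ → ℝ) (y : ℝ) : ℝ := ((AA p y).ncard : ℝ)

/-- Increment of `PhiJ`. -/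
noncomputable def dJ (p : ℕ → ℝ) (lam : ℝ) (j : ℕ) (t : ℝ) : ℝ := PhiJ p j (lam * t) - PhiJ p j t

lemma AA_finite {p : ℕ → ℝ} (hs : Summable p) (y : ℝ) : (AA p y).Finite := by
  have h := hs.tendsto_cofinite_zero.eventually_lt_const (Real.exp_pos (-y))
  rw [Filter.eventually_cofinite] at h
  simpa [AA] using h

lemma AA_mono {p : ℕ → ℝ} {x y : ℝ} (h : x ≤ y) : AA p x ⊆ AA p y := fun k hk =>
  le_trans (Real.exp_le_exp.2 (by linarith)) hk

lemma NN_mono {p : ℕ → ℝ} (hs : Summable p) : Monotone (NN p) := fun x y h => by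
  unfold NN
  exact_mod_cast Set.ncard_le_ncard (AA_mono h) (AA_finite hs y)

lemma NN_nonneg (p : ℕ → ℝ) (y : ℝ) : 0 ≤ NN p y := by unfold NN; positivity

lemma rhoJ_one (p : ℕ → ℝ) (t : ℝ) (ht : 0 < t) : rhoJ p 1 t = NN p (Real.log t) := by
  unfold rhoJ NN AA
  rw [← Nat.card_coe_set_eq]
  congr 1
  refine Nat.card_congr ((Equiv.funUnique (Fin 1) ℕ).subtypeEquiv fun r => ?_)
  simp [prodP, Real.exp_neg, Real.exp_log ht]

lemma prodP_nonneg {p : ℕ → ℝ} (hp0 : ∀ k, 0 ≤ p k) (j : ℕ) (r : Fin j → ℕ) : 0 ≤ prodP p j r :=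
  Finset.prod_nonneg fun _ _ => hp0 _

lemma prodP_cons (p : ℕ → ℝ) (j : ℕ) (k : ℕ) (r : Fin j → ℕ) :
    prodP p (j + 1) (Fin.consEquiv (fun _ => ℕ) (k, r)) = p k * prodP p j r := by
  simp [prodP, Fin.prod_univ_succ, Fin.consEquiv]

lemma prodP_hasSum {p : ℕ → ℝ} (hp0 : ∀ k, 0 ≤ p k) (hp : HasSum p 1) (j : ℕ) :
    HasSum (prodP p j) 1 := by
  induction j with
  | zero =>
    have : HasSum (prodP p 0) (∑ r : Fin 0 → ℕ, prodP p 0 r) := hasSum_fintype _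
    simpa [prodP] using this
  | succ j ih =>
    rw [← (Fin.consEquiv (fun _ => ℕ)).hasSum_iff]
    have hsum : Summable fun x : ℕ × (Fin j → ℕ) => p x.1 * prodP p j x.2 :=
      hp.summable.mul_of_nonneg ih.summable hp0 (prodP_nonneg hp0 j)
    have := hp.mul ih hsum
    rw [one_mul] at this
    have e : (prodP p (j + 1) ∘ (Fin.consEquiv (fun _ => ℕ))) =
        fun x : ℕ × (Fin j → ℕ) => p x.1 * prodP p j x.2 := by
      funext x
      exact prodP_cons p j x.1 x.2
    rw [e]
    exact this

lemma term_bounds {t a : ℝ} (ht : 0 ≤ t) (ha : 0 ≤ a) :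
    0 ≤ 1 - Real.exp (-t * a) ∧ 1 - Real.exp (-t * a) ≤ t * a := by
  have h1 : Real.exp (-t * a) ≤ 1 := Real.exp_le_one_iff.2 (by nlinarith [mul_nonneg ht ha])
  have h2 := Real.add_one_le_exp (-t * a)
  constructor <;> linarith

lemma Phi_summable {p : ℕ → ℝ} (hp0 : ∀ k, 0 ≤ p k) (hp : HasSum p 1) (j : ℕ) {t : ℝ} (ht : 0 ≤ t) :
    Summable fun r : Fin j → ℕ => 1 - Real.exp (-t * prodP p j r) :=
  Summable.of_nonneg_of_le (fun r => (term_bounds ht (prodP_nonneg hp0 j r)).1)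
    (fun r => (term_bounds ht (prodP_nonneg hp0 j r)).2)
    ((prodP_hasSum hp0 hp j).summable.mul_left t)

lemma Phi_rec {p : ℕ → ℝ} (hp0 : ∀ k, 0 ≤ p k) (hp : HasSum p 1) (j : ℕ) {t : ℝ} (ht : 0 ≤ t) :
    HasSum (fun k => PhiJ p j (t * p k)) (PhiJ p (j + 1) t) := by
  have h1 := (Phi_summable hp0 hp (j + 1) ht).hasSum
  rw [← (Fin.consEquiv (fun _ => ℕ)).hasSum_iff] at h1
  refine h1.prod_fiberwise fun k => ?_
  have h2 := (Phi_summable hp0 hp j (mul_nonneg ht (hp0 k))).hasSum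
  have e : ∀ r : Fin j → ℕ, ((fun r => 1 - Real.exp (-t * prodP p (j + 1) r)) ∘
      (Fin.consEquiv (fun _ => ℕ))) (k, r) = 1 - Real.exp (-(t * p k) * prodP p j r) := by
    intro r
    simp only [Function.comp]
    rw [prodP_cons]
    ring_nf
  simp only [e]
  exact h2

lemma dJ_rec {p : ℕ → ℝ} (hp0 : ∀ k, 0 ≤ p k) (hp : HasSum p 1) (j : ℕ) {t lam : ℝ} (ht : 0 ≤ t)
    (hl : 1 ≤ lam) : HasSum (fun k => dJ p lam j (t * p k)) (dJ p lam (j + 1) t) := by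
  have h := (Phi_rec hp0 hp j (t := lam * t) (by positivity)).sub (Phi_rec hp0 hp j ht)
  simpa only [dJ, mul_assoc] using h

lemma dJ_bounds {p : ℕ → ℝ} (hp0 : ∀ k, 0 ≤ p k) (hp : HasSum p 1) (j : ℕ) {t lam : ℝ} (ht : 0 ≤ t)
    (hl : 1 ≤ lam) : 0 ≤ dJ p lam j t ∧ dJ p lam j t ≤ (lam - 1) * t := by
  have h1 := (Phi_summable hp0 hp j (t := lam * t) (by positivity)).hasSum.sub
    (Phi_summable hp0 hp j ht).hasSum
  have h1' : HasSum _ (dJ p lam j t) := h1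
  have hb : ∀ r : Fin j → ℕ, 0 ≤ (1 - Real.exp (-(lam * t) * prodP p j r)) -
      (1 - Real.exp (-t * prodP p j r)) ∧ (1 - Real.exp (-(lam * t) * prodP p j r)) -
      (1 - Real.exp (-t * prodP p j r)) ≤ (lam - 1) * t * prodP p j r := by
    intro r
    have ha := prodP_nonneg hp0 j r
    set a := prodP p j r
    have hta := mul_nonneg ht ha
    have h2 := term_bounds (t := (lam - 1) * t) (a := a) (mul_nonneg (by linarith) ht) ha
    have e : Real.exp (-(lam * t) * a) = Real.exp (-t * a) * Real.exp (-((lam - 1) * t) * a) := by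
      rw [← Real.exp_add]; ring_nf
    have h3 : Real.exp (-t * a) ≤ 1 := Real.exp_le_one_iff.2 (by linarith)
    have h4 := Real.exp_pos (-t * a)
    rw [e]
    constructor <;> nlinarith
  constructor
  · exact h1'.nonneg fun r => (hb r).1
  · have := hasSum_le (fun r => (hb r).2) h1' ((prodP_hasSum hp0 hp j).mul_left _)
    simpa using this

lemma dJ_zero (p : ℕ → ℝ) (lam s : ℝ) : dJ p lam 0 s = Real.exp (-s) - Real.exp (-(lam * s)) := by
  simp [dJ, PhiJ, prodP]

lemma dJ_small (p : ℕ → ℝ) {lam s : ℝ} (hl : 1 ≤ lam) (hs0 : 0 ≤ s) (hs : s ≤ 1) :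
    (lam - 1) * s ≤ Real.exp lam * dJ p lam 0 s := by
  rw [dJ_zero]
  have h1 := Real.add_one_le_exp ((lam - 1) * s)
  have e : Real.exp (-s) = Real.exp (-(lam * s)) * Real.exp ((lam - 1) * s) := by
    rw [← Real.exp_add]; ring_nf
  rw [e]
  have h2 : 1 ≤ Real.exp lam * Real.exp (-(lam * s)) := by
    rw [← Real.exp_add]; exact Real.one_le_exp (by nlinarith)
  have h3 : 0 ≤ (lam - 1) * s := mul_nonneg (by linarith) hs0
  nlinarith

lemma card_diff_hasSum {p : ℕ → ℝ} (hs : Summable p) {y z : ℝ} (hyz : y ≤ z) (c : ℝ) :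
    HasSum (fun k => (AA p z \ AA p y).indicator (fun _ => c) k) ((NN p z - NN p y) * c) := by
  classical
  have hfin : (AA p z \ AA p y).Finite := (AA_finite hs z).subset Set.sdiff_subset
  have h1 : HasSum (fun k => (AA p z \ AA p y).indicator (fun _ => c) k)
      (∑ k ∈ hfin.toFinset, (AA p z \ AA p y).indicator (fun _ => c) k) := by
    apply hasSum_sum_of_ne_finset_zero
    intro k hk
    rw [Set.indicator_of_notMem]
    simpa using hk
  have h2 : ∑ k ∈ hfin.toFinset, (AA p z \ AA p y).indicator (fun _ => c) k
      = (NN p z - NN p y) * c := by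
    have h3 : ∑ k ∈ hfin.toFinset, (AA p z \ AA p y).indicator (fun _ => c) k
        = ∑ k ∈ hfin.toFinset, c := by
      refine Finset.sum_congr rfl fun k hk => ?_
      rw [Set.indicator_of_mem]
      simpa using hk
    rw [h3, Finset.sum_const, nsmul_eq_mul]
    congr 1
    have h4 := Set.ncard_sdiff_add_ncard_of_subset (AA_mono (p := p) hyz) (AA_finite hs z)
    rw [← Set.ncard_eq_toFinset_card _ hfin]
    unfold NN
    rw [← h4]
    push_cast
    ring
  rwa [h2] at h1

open MeasureTheory in
lemma d1_integral {p : ℕ → ℝ} (hp0 : ∀ k, 0 ≤ p k) (hp : HasSum p 1) {lam : ℝ} (hl : 1 < lam)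
    (x : ℝ) : dJ p lam 1 (Real.exp x) = ∫ v in Set.Ioi (0 : ℝ),
      (NN p (x - Real.log v + Real.log lam) - NN p (x - Real.log v)) * Real.exp (-v) := by
  set s : ℕ → ℝ := fun k => Real.exp x * p k with hsdef
  have hs0 : ∀ k, 0 ≤ s k := fun k => mul_nonneg (Real.exp_pos _).le (hp0 k)
  have hsl : ∀ k, s k ≤ lam * s k := fun k => by nlinarith [hs0 k]
  set F : ℕ → ℝ → ℝ := fun k v => (Set.Ioc (s k) (lam * s k)).indicator (fun v => Real.exp (-v)) v
  have hFnn : ∀ k v, 0 ≤ F k v := fun k v => Set.indicator_nonneg (fun _ _ => (Real.exp_pos _).le) _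
  have hsubset : ∀ k, Set.Ioc (s k) (lam * s k) ⊆ Set.Ioi 0 := fun k v hv =>
    lt_of_le_of_lt (hs0 k) hv.1
  have hint : ∀ k, ∫ v in Set.Ioi (0 : ℝ), F k v = dJ p lam 0 (s k) := by
    intro k
    rw [setIntegral_indicator measurableSet_Ioc, Set.inter_eq_self_of_subset_right (hsubset k),
      ← intervalIntegral.integral_of_le (hsl k), intervalIntegral.integral_comp_neg (fun v => Real.exp v),
      integral_exp, dJ_zero]
  have hFi : ∀ k, Integrable (F k) (volume.restrict (Set.Ioi (0 : ℝ))) := by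
    intro k
    refine Integrable.indicator ?_ measurableSet_Ioc
    exact integrableOn_exp_neg_Ioi 0
  have hrec := dJ_rec hp0 hp 0 (Real.exp_pos x).le hl.le
  have hsum := hasSum_integral_of_summable_integral_norm hFi (by
    refine hrec.summable.congr fun k => ?_
    rw [← hint k]
    refine integral_congr_ae (Eventually.of_forall fun v => ?_)
    simp only [Real.norm_of_nonneg (hFnn k v)])
  simp only [hint] at hsum
  have := hrec.unique hsum
  rw [zero_add] at this
  rw [this]
  refine setIntegral_congr_fun measurableSet_Ioi fun v hv => ?_
  have hv0 : 0 < v := hv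
  have hl0 : 0 < Real.log lam := Real.log_pos hl
  have h1 := card_diff_hasSum hp.summable
    (show x - Real.log v ≤ x - Real.log v + Real.log lam by linarith) (Real.exp (-v))
  rw [← h1.tsum_eq]
  refine tsum_congr fun k => ?_
  have e1 : k ∈ AA p (x - Real.log v) ↔ v ≤ s k := by
    simp only [AA, Set.mem_ofPred_eq, hsdef]
    rw [neg_sub, Real.exp_sub, Real.exp_log hv0, div_le_iff₀ (Real.exp_pos _), mul_comm]
  have e2 : k ∈ AA p (x - Real.log v + Real.log lam) ↔ v ≤ lam * s k := by
    simp only [AA, Set.mem_ofPred_eq, hsdef]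
    rw [neg_add, neg_sub, Real.exp_add, Real.exp_sub, Real.exp_neg, Real.exp_log hv0,
      Real.exp_log (by linarith), ← div_eq_mul_inv, div_div, div_le_iff₀ (by positivity)]
    rw [show p k * (Real.exp x * lam) = lam * (Real.exp x * p k) by ring]
  by_cases hm : v ∈ Set.Ioc (s k) (lam * s k)
  · rw [Set.indicator_of_mem (show k ∈ _ from ?_)]
    · exact Set.indicator_of_mem hm _
    · exact ⟨e2.2 hm.2, fun h => absurd (e1.1 h) (not_le.2 hm.1)⟩
  · rw [Set.indicator_of_notMem (show k ∉ _ from ?_)]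
    · exact Set.indicator_of_notMem hm _
    · exact fun h => hm ⟨not_le.1 fun h' => h.2 (e1.2 h'), e2.1 h.1⟩

open MeasureTheory in
lemma base_case {p : ℕ → ℝ} (hp0 : ∀ k, 0 ≤ p k) (hp : HasSum p 1) {lam : ℝ} (hl : 1 < lam)
    (hpt : ∀ w, Tendsto (fun x => (NN p (x - w + Real.log lam) - NN p (x - w)) /
      (NN p (x + 1) - NN p x)) atTop (𝓝 (Real.log lam)))
    (hU1 : ∀ᶠ x in atTop, 1 ≤ NN p (x + 1) - NN p x)
    (hg : ∃ C X, 0 ≤ C ∧ ∀ x ≥ X, ∀ y, NN p (y + Real.log lam) - NN p y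
      ≤ C * Real.exp (|x - y| / 2) * (NN p (x + 1) - NN p x)) :
    Tendsto (fun x => dJ p lam 1 (Real.exp x) / (NN p (x + 1) - NN p x)) atTop
      (𝓝 (Real.log lam)) := by
  obtain ⟨C, X, hC0, hC⟩ := hg
  have hNm : Measurable (NN p) := (NN_mono hp.summable).measurable
  have hl0 : 0 < Real.log lam := Real.log_pos hl
  have hlim : Tendsto (fun x => ∫ v in Set.Ioi (0 : ℝ),
      (NN p (x - Real.log v + Real.log lam) - NN p (x - Real.log v)) /
      (NN p (x + 1) - NN p x) * Real.exp (-v)) atTop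
      (𝓝 (∫ v in Set.Ioi (0 : ℝ), Real.log lam * Real.exp (-v))) := by
    refine tendsto_integral_filter_of_dominated_convergence
      (fun v => C * (Real.exp (-v) * v ^ ((3/2 : ℝ) - 1) + Real.exp (-v) * v ^ ((1/2 : ℝ) - 1))) ?_ ?_ ?_ ?_
    · refine Eventually.of_forall fun x => Measurable.aestronglyMeasurable ?_
      have m1 : Measurable fun v : ℝ => x - Real.log v := Real.measurable_log.const_sub x
      exact (((hNm.comp (m1.add_const _)).sub (hNm.comp m1)).div_const _).mul
        (Real.measurable_exp.comp measurable_neg)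
    · filter_upwards [hU1, eventually_ge_atTop X] with x hx hxX
      refine (ae_restrict_mem measurableSet_Ioi).mono fun v hv => ?_
      have hv0 : 0 < v := hv
      have hU0 : 0 < NN p (x + 1) - NN p x := by linarith
      have h1 := hC x hxX (x - Real.log v)
      have h2 : 0 ≤ NN p (x - Real.log v + Real.log lam) - NN p (x - Real.log v) :=
        sub_nonneg.2 (NN_mono hp.summable (by linarith))
      rw [Real.norm_of_nonneg (mul_nonneg (div_nonneg h2 hU0.le) (Real.exp_pos _).le)]
      rw [← div_le_iff₀ hU0] at h1
      have h3 : Real.exp (|x - (x - Real.log v)| / 2) ≤ v ^ ((3/2 : ℝ) - 1) + v ^ ((1/2 : ℝ) - 1) := by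
        rw [sub_sub_cancel, Real.rpow_def_of_pos hv0, Real.rpow_def_of_pos hv0]
        rcases abs_cases (Real.log v) with ⟨h, _⟩ | ⟨h, _⟩
        · rw [h]
          have : Real.log v / 2 = Real.log v * (3 / 2 - 1) := by ring
          rw [this]
          linarith [Real.exp_pos (Real.log v * (1 / 2 - 1))]
        · rw [h]
          have : -Real.log v / 2 = Real.log v * (1 / 2 - 1) := by ring
          rw [this]
          linarith [Real.exp_pos (Real.log v * (3 / 2 - 1))]
      have h4 := h1.trans (mul_le_mul_of_nonneg_left h3 hC0)
      have h5 := mul_le_mul_of_nonneg_right h4 (Real.exp_pos (-v)).le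
      refine h5.trans (le_of_eq ?_)
      ring
    · exact ((Real.GammaIntegral_convergent (by norm_num)).add
        (Real.GammaIntegral_convergent (by norm_num))).const_mul C
    · refine Eventually.of_forall fun v => (hpt (Real.log v)).mul_const _
  have e : (∫ v in Set.Ioi (0 : ℝ), Real.log lam * Real.exp (-v)) = Real.log lam := by
    rw [integral_const_mul, integral_exp_neg_Ioi_zero, mul_one]
  rw [e] at hlim
  refine hlim.congr fun x => ?_
  rw [d1_integral hp0 hp hl x, ← integral_div]
  refine integral_congr_ae (Eventually.of_forall fun v => ?_)
  simp only
  ring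

lemma real_beta (a d : ℝ) (ha : 0 < a) (hd : 0 < d) :
    ∫ u in (0 : ℝ)..1, u ^ (a - 1) * (1 - u) ^ (d - 1) =
      Real.Gamma a * Real.Gamma d / Real.Gamma (a + d) := by
  have h := ProbabilityTheory.beta_eq_betaIntegralReal a d ha hd
  rw [ProbabilityTheory.beta] at h
  rw [h]
  have e : Complex.betaIntegral a d
      = ((∫ u in (0 : ℝ)..1, u ^ (a - 1) * (1 - u) ^ (d - 1) : ℝ) : ℂ) := by
    rw [Complex.betaIntegral, ← intervalIntegral.integral_ofReal]
    refine intervalIntegral.integral_congr fun u hu => ?_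
    rw [Set.uIcc_of_le zero_le_one] at hu
    have h1 : 0 ≤ 1 - u := by linarith [hu.2]
    rw [Complex.ofReal_mul, Complex.ofReal_cpow hu.1, Complex.ofReal_cpow h1]
    push_cast
    rfl
  rw [e, Complex.ofReal_re]

open MeasureTheory in
lemma layer_int {p : ℕ → ℝ} (hp0 : ∀ k, 0 ≤ p k) (hp : HasSum p 1) (c : ℝ) (hc : 0 < c)
    (x : ℝ) (hx : 0 < x) :
    ∑ k ∈ (AA_finite hp.summable x).toFinset, (1 + Real.log (p k) / x) ^ c
      = ∫ u in Set.Ioc (0 : ℝ) 1, NN p (u * x) * (c * (1 - u) ^ (c - 1)) := by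
  classical
  set S := (AA_finite hp.summable x).toFinset with hS
  set g : ℝ → ℝ := fun u => c * (1 - u) ^ (c - 1) with hg
  have hgi : IntegrableOn g (Set.Icc 0 1) := by
    have h1 : IntervalIntegrable (fun v : ℝ => c * v ^ (c - 1)) volume (1 - 0) (1 - 1) :=
      (intervalIntegral.intervalIntegrable_rpow' (by linarith)).const_mul c
    have h2 := h1.comp_sub_left 1
    simp only [sub_zero, sub_self] at h2
    rw [integrableOn_Icc_iff_integrableOn_Ioc]
    exact (intervalIntegrable_iff_integrableOn_Ioc_of_le zero_le_one).1 h2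
  set uu : ℕ → ℝ := fun k => -Real.log (p k) / x with huu
  have hple : ∀ k, p k ≤ 1 := fun k => le_hasSum hp k (fun i _ => hp0 i)
  have hmem : ∀ k ∈ S, 0 < p k ∧ 0 ≤ uu k ∧ uu k ≤ 1 := by
    intro k hk
    have hk' : Real.exp (-x) ≤ p k := by simpa [hS, AA] using hk
    have h1 : 0 < p k := lt_of_lt_of_le (Real.exp_pos _) hk'
    refine ⟨h1, ?_, ?_⟩
    · exact div_nonneg (neg_nonneg.2 (Real.log_nonpos (hp0 k) (hple k))) hx.le
    · rw [huu]
      simp only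
      rw [div_le_one hx]
      have := (Real.le_log_iff_exp_le h1).2 hk'
      linarith
  have h1 : ∀ k ∈ S, (1 + Real.log (p k) / x) ^ c
      = ∫ u in Set.Icc (0 : ℝ) 1, (Set.Ici (uu k)).indicator g u := by
    intro k hk
    obtain ⟨_, hu0, hu1⟩ := hmem k hk
    rw [setIntegral_indicator measurableSet_Ici]
    have : Set.Icc (0 : ℝ) 1 ∩ Set.Ici (uu k) = Set.Icc (uu k) 1 := by
      ext v
      simp only [Set.mem_inter_iff, Set.mem_Icc, Set.mem_Ici]
      constructor
      · rintro ⟨⟨_, h2⟩, h3⟩; exact ⟨h3, h2⟩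
      · rintro ⟨h2, h3⟩; exact ⟨⟨hu0.trans h2, h3⟩, h2⟩
    rw [this, integral_Icc_eq_integral_Ioc, ← intervalIntegral.integral_of_le hu1,
      hg, intervalIntegral.integral_comp_sub_left (fun v : ℝ => c * v ^ (c - 1)) 1,
      intervalIntegral.integral_const_mul, integral_rpow (Or.inl (by linarith))]
    have e : 1 + Real.log (p k) / x = 1 - uu k := by rw [huu]; ring
    rw [e]
    simp only [sub_self, sub_add_cancel]
    rw [Real.zero_rpow hc.ne']
    field_simp
    ring
  rw [Finset.sum_congr rfl h1, ← integral_finsetSum _ (fun k _ => hgi.indicator measurableSet_Ici),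
    ← integral_Icc_eq_integral_Ioc]
  refine setIntegral_congr_fun measurableSet_Icc fun u hu => ?_
  have h2 : ∑ k ∈ S, (Set.Ici (uu k)).indicator g u
      = ∑ k ∈ S, if k ∈ AA p (u * x) then g u else 0 := by
    refine Finset.sum_congr rfl fun k hk => ?_
    obtain ⟨hp', _, _⟩ := hmem k hk
    have : k ∈ AA p (u * x) ↔ u ∈ Set.Ici (uu k) := by
      simp only [AA, Set.mem_ofPred_eq, Set.mem_Ici, huu]
      rw [div_le_iff₀ hx, ← Real.le_log_iff_exp_le hp']
      constructor <;> intro h <;> linarith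
    rw [Set.indicator_apply]
    simp only [this]
  rw [h2, ← Finset.sum_filter, Finset.sum_const, nsmul_eq_mul]
  congr 1
  unfold NN
  rw [← Set.ncard_coe_finset]
  congr 2
  ext k
  simp only [hS, Finset.coe_filter, Set.Finite.mem_toFinset, Set.mem_ofPred_eq]
  constructor
  · exact fun h => h.2
  · exact fun h => ⟨AA_mono (by nlinarith [hu.2]) h, h⟩

open MeasureTheory in
lemma layer_lim {p : ℕ → ℝ} (hp0 : ∀ k, 0 ≤ p k) (hp : HasSum p 1) (c b : ℝ) (hc : 0 ≤ c)
    (hb : 0 < b) (hpos : ∀ᶠ x in atTop, 0 < NN p x)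
    (hreg : ∀ u > 0, Tendsto (fun x => NN p (u * x) / NN p x) atTop (𝓝 (u ^ b))) :
    Tendsto (fun x => (∑ k ∈ (AA_finite hp.summable x).toFinset, (1 + Real.log (p k) / x) ^ c)
      / NN p x) atTop (𝓝 (Real.Gamma (c + 1) * Real.Gamma (b + 1) / Real.Gamma (c + b + 1))) := by
  rcases hc.eq_or_lt with rfl | hc
  · have e : Real.Gamma (0 + 1) * Real.Gamma (b + 1) / Real.Gamma (0 + b + 1) = 1 := by
      simp only [zero_add, Real.Gamma_one, one_mul]
      exact div_self (Real.Gamma_pos_of_pos (by linarith)).ne'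
    rw [e]
    refine tendsto_const_nhds.congr' ?_
    filter_upwards [hpos] with x hx
    simp only [Real.rpow_zero, Finset.sum_const, nsmul_eq_mul, mul_one]
    rw [← Set.ncard_eq_toFinset_card _ (AA_finite hp.summable x)]
    exact (div_self hx.ne').symm
  have hNm : Measurable (NN p) := (NN_mono hp.summable).measurable
  have hlim : Tendsto (fun x => ∫ u in Set.Ioc (0 : ℝ) 1,
      NN p (u * x) / NN p x * (c * (1 - u) ^ (c - 1))) atTop
      (𝓝 (∫ u in Set.Ioc (0 : ℝ) 1, u ^ b * (c * (1 - u) ^ (c - 1)))) := by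
    refine tendsto_integral_filter_of_dominated_convergence
      (fun u => c * (1 - u) ^ (c - 1)) ?_ ?_ ?_ ?_
    · refine Eventually.of_forall fun x => Measurable.aestronglyMeasurable ?_
      refine ((hNm.comp (measurable_id.mul_const x)).div_const _).mul ?_
      exact ((measurable_id.const_sub 1).pow_const _).const_mul c
    · filter_upwards [hpos, eventually_gt_atTop 0] with x hx hx0
      refine (ae_restrict_mem measurableSet_Ioc).mono fun u hu => ?_
      have h1 : 0 ≤ c * (1 - u) ^ (c - 1) :=
        mul_nonneg hc.le (Real.rpow_nonneg (by linarith [hu.2]) _)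
      have h2 : NN p (u * x) / NN p x ≤ 1 := by
        rw [div_le_one hx]
        exact NN_mono hp.summable (by nlinarith [hu.2])
      have h3 : 0 ≤ NN p (u * x) / NN p x := div_nonneg (NN_nonneg _ _) hx.le
      rw [Real.norm_of_nonneg (mul_nonneg h3 h1)]
      nlinarith
    · have h1 : IntervalIntegrable (fun v : ℝ => c * v ^ (c - 1)) volume (1 - 0) (1 - 1) :=
        (intervalIntegral.intervalIntegrable_rpow' (by linarith)).const_mul c
      have h2 := h1.comp_sub_left 1
      simp only [sub_zero, sub_self] at h2
      exact (intervalIntegrable_iff_integrableOn_Ioc_of_le zero_le_one).1 h2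
    · refine (ae_restrict_mem measurableSet_Ioc).mono fun u hu => ?_
      exact (hreg u hu.1).mul_const _
  have e : ∫ u in Set.Ioc (0 : ℝ) 1, u ^ b * (c * (1 - u) ^ (c - 1))
      = Real.Gamma (c + 1) * Real.Gamma (b + 1) / Real.Gamma (c + b + 1) := by
    rw [← intervalIntegral.integral_of_le zero_le_one]
    have := real_beta (b + 1) c (by linarith) hc
    rw [add_sub_cancel_right] at this
    rw [show c + b + 1 = b + 1 + c by ring, Real.Gamma_add_one hc.ne']
    calc _ = ∫ u in (0 : ℝ)..1, c * (u ^ b * (1 - u) ^ (c - 1)) := by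
            congr 1; funext u; ring
      _ = _ := by rw [intervalIntegral.integral_const_mul, this]; ring
  rw [e] at hlim
  refine hlim.congr' ?_
  filter_upwards [hpos, eventually_gt_atTop 0] with x hx hx0
  rw [layer_int hp0 hp c hc x hx0, ← integral_div]
  refine integral_congr_ae (Eventually.of_forall fun v => ?_)
  simp only
  ring

lemma step_unif {p : ℕ → ℝ} (hp : HasSum p 1) {lam : ℝ} (b : ℝ)
    (j : ℕ) (K : ℝ) (hNt : Tendsto (NN p) atTop atTop)
    (hreg : ∀ u > 0, Tendsto (fun x => NN p (u * x) / NN p x) atTop (𝓝 (u ^ b)))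
    (hK : Tendsto (fun x => dJ p lam j (Real.exp x) / (NN p x ^ j / x)) atTop (𝓝 K))
    (ε η : ℝ) (hε : 0 < ε) (hη : 0 < η) :
    ∀ᶠ x in atTop, ∀ s ∈ Set.Icc ε 1,
      |dJ p lam j (Real.exp (s * x)) / (NN p x ^ j / x) - K * s ^ ((j : ℝ) * b - 1)| < η := by
  have hpos : ∀ᶠ x in atTop, 0 < NN p x := hNt.eventually_gt_atTop 0
  have hpt : ∀ s > 0, Tendsto (fun z : ℝ × ℝ => dJ p lam j (Real.exp (z.2 * z.1)) /
      (NN p z.1 ^ j / z.1)) (atTop ×ˢ 𝓝 s) (𝓝 (K * s ^ ((j : ℝ) * b - 1))) := by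
    intro s hs
    have hmul : Tendsto (fun z : ℝ × ℝ => z.2 * z.1) (atTop ×ˢ 𝓝 s) atTop :=
      tendsto_snd.pos_mul_atTop hs tendsto_fst
    have h1 := hK.comp hmul
    have h2 := N_cont (NN p) (NN_mono hp.summable) b hpos hreg s hs
    have h3 := (h1.mul (h2.pow j)).div (tendsto_snd (f := (atTop : Filter ℝ)) (g := 𝓝 s)) hs.ne'
    have e : K * (s ^ b) ^ j / s = K * s ^ ((j : ℝ) * b - 1) := by
      rw [Real.rpow_sub hs, Real.rpow_one, mul_comm (j : ℝ) b, Real.rpow_mul hs.le,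
        Real.rpow_natCast]
      ring
    rw [e] at h3
    refine h3.congr' ?_
    filter_upwards [tendsto_fst.eventually (hpos.and (eventually_gt_atTop 0)), hmul.eventually hpos,
      tendsto_snd.eventually (lt_mem_nhds hs)] with z hz1 hz2 hz3
    have a1 := hz1.1.ne'
    have a2 := hz1.2.ne'
    have a3 := hz2.ne'
    have a4 := hz3.ne'
    simp only [Function.comp, Pi.div_apply, div_pow]
    field_simp
  have hU : TendstoUniformlyOn (fun x s => dJ p lam j (Real.exp (s * x)) / (NN p x ^ j / x))
      (fun s => K * s ^ ((j : ℝ) * b - 1)) atTop (Set.Icc ε 1) := by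
    rw [← tendstoLocallyUniformlyOn_iff_tendstoUniformlyOn_of_compact isCompact_Icc,
      tendstoLocallyUniformlyOn_iff_forall_tendsto]
    intro s hs
    have hs0 : 0 < s := lt_of_lt_of_le hε hs.1
    have h1 := (hpt s hs0).mono_left (Filter.prod_mono le_rfl
      (nhdsWithin_le_nhds (s := Set.Icc ε 1)))
    have h2 : Tendsto (fun z : ℝ × ℝ => K * z.2 ^ ((j : ℝ) * b - 1)) (atTop ×ˢ 𝓝[Set.Icc ε 1] s)
        (𝓝 (K * s ^ ((j : ℝ) * b - 1))) := by
      have hc : ContinuousAt (fun u : ℝ => K * u ^ ((j : ℝ) * b - 1)) s :=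
        (Real.continuousAt_rpow_const _ _ (Or.inl hs0.ne')).const_mul K
      exact (hc.tendsto.comp (tendsto_snd.mono_right nhdsWithin_le_nhds))
    exact (h2.prodMk_nhds h1).mono_right (nhds_prod_eq.trans_le (by
      rw [← nhds_prod_eq]; exact nhds_le_uniformity _))
  have := Metric.tendstoUniformlyOn_iff.1 hU η hη
  filter_upwards [this] with x hx s hs
  have := hx s hs
  rwa [dist_comm, Real.dist_eq] at this

lemma step_bdd {p : ℕ → ℝ} (hp0 : ∀ k, 0 ≤ p k) (hp : HasSum p 1) {lam : ℝ} (hl : 1 < lam)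
    (j : ℕ) (hj1 : 1 ≤ j) (K : ℝ) (hNt : Tendsto (NN p) atTop atTop)
    (hH : ∃ C > 0, ∃ X > 0, ∀ y x, X ≤ y → y ≤ x → NN p y / y ≤ C * (NN p x / x))
    (hK : Tendsto (fun x => dJ p lam j (Real.exp x) / (NN p x ^ j / x)) atTop (𝓝 K)) :
    ∃ C1 ≥ 0, ∀ᶠ x in atTop, ∀ y ≤ x, dJ p lam j (Real.exp y) ≤ C1 * (NN p x ^ j / x) := by
  obtain ⟨C, hC, X, hX0, hH⟩ := hH
  obtain ⟨i, rfl⟩ : ∃ i, j = i + 1 := ⟨j - 1, by omega⟩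
  have hK1 := hK.eventually_lt_const (show K < |K| + 1 by linarith [le_abs_self K])
  obtain ⟨Y, hY⟩ := eventually_atTop.1 (hK1.and ((hNt.eventually_ge_atTop 1).and
    (eventually_ge_atTop X)))
  have hYX := (hY Y le_rfl).2.2
  have hY1 := (hY Y le_rfl).2.1
  have hY0 : 0 < Y := hX0.trans_le hYX
  set M := (lam - 1) * Real.exp Y with hM
  have hM0 : 0 ≤ M := mul_nonneg (by linarith) (Real.exp_pos _).le
  set a := NN p Y / Y with ha
  have ha0 : 0 < a := by positivity
  have hQ : ∀ x ≥ Y, ∀ y ≥ Y, y ≤ x → NN p y ^ (i + 1) / y ≤ C * (NN p x ^ (i + 1) / x) := by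
    intro x hx y hy hyx
    have h1 := hH y x (hYX.trans hy) hyx
    have h2 : NN p y ^ i ≤ NN p x ^ i :=
      pow_le_pow_left₀ (NN_nonneg _ _) (NN_mono hp.summable hyx) i
    have hy0 : 0 < y := hY0.trans_le hy
    calc NN p y ^ (i + 1) / y = NN p y ^ i * (NN p y / y) := by ring
      _ ≤ NN p x ^ i * (C * (NN p x / x)) :=
          mul_le_mul h2 h1 (div_nonneg (NN_nonneg _ _) hy0.le) (pow_nonneg (NN_nonneg _ _) _)
      _ = _ := by ring
  have hQ1 : ∀ x ≥ Y, a ≤ C * (NN p x ^ (i + 1) / x) := by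
    intro x hx
    refine le_trans ?_ (hQ x hx Y le_rfl hx)
    rw [ha]
    gcongr
    exact le_self_pow₀ hY1 (by omega)
  refine ⟨(|K| + 1) * C + M * C / a, by positivity, ?_⟩
  filter_upwards [eventually_ge_atTop Y] with x hx y hyx
  have hx0 : 0 < x := hY0.trans_le hx
  have hQn : 0 ≤ NN p x ^ (i + 1) / x := div_nonneg (pow_nonneg (NN_nonneg _ _) _) hx0.le
  by_cases hy : Y ≤ y
  · have h1 := (hY y hy)
    have hy0 : 0 < y := hY0.trans_le hy
    have hN0 : 0 < NN p y := lt_of_lt_of_le one_pos h1.2.1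
    have h2 := h1.1
    rw [div_lt_iff₀ (by positivity)] at h2
    have h3 := hQ x hx y hy hyx
    have h4 : (|K| + 1) * (NN p y ^ (i + 1) / y) ≤ (|K| + 1) * (C * (NN p x ^ (i + 1) / x)) :=
      mul_le_mul_of_nonneg_left h3 (by positivity)
    have h5 : 0 ≤ M * C / a * (NN p x ^ (i + 1) / x) := mul_nonneg (by positivity) hQn
    nlinarith
  · push Not at hy
    have h1 := (dJ_bounds hp0 hp (i + 1) (Real.exp_pos y).le hl.le).2
    have h2 : (lam - 1) * Real.exp y ≤ M :=
      mul_le_mul_of_nonneg_left (Real.exp_le_exp.2 hy.le) (by linarith)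
    have h3 : M ≤ M * C / a * (NN p x ^ (i + 1) / x) := by
      have h4 := mul_le_mul_of_nonneg_left (hQ1 x hx) (div_nonneg hM0 ha0.le)
      have e1 : M / a * a = M := div_mul_cancel₀ _ ha0.ne'
      rw [e1] at h4
      refine h4.trans (le_of_eq ?_)
      ring
    have h5 : 0 ≤ (|K| + 1) * C * (NN p x ^ (i + 1) / x) := mul_nonneg (by positivity) hQn
    linarith

lemma step_rest {p : ℕ → ℝ} (hp0 : ∀ k, 0 ≤ p k) (hp : HasSum p 1) {lam : ℝ} (hl : 1 < lam)
    (j : ℕ) (x : ℝ) :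
    0 ≤ dJ p lam (j + 1) (Real.exp x) -
      ∑ k ∈ (AA_finite hp.summable x).toFinset, dJ p lam j (Real.exp x * p k) ∧
    dJ p lam (j + 1) (Real.exp x) -
      ∑ k ∈ (AA_finite hp.summable x).toFinset, dJ p lam j (Real.exp x * p k)
      ≤ Real.exp lam * dJ p lam 1 (Real.exp x) := by
  classical
  set S := (AA_finite hp.summable x).toFinset with hS
  have hA := dJ_rec hp0 hp j (Real.exp_pos x).le hl.le
  have hB := (dJ_rec hp0 hp 0 (Real.exp_pos x).le hl.le).mul_left (Real.exp lam)
  have hs0 : ∀ k, 0 ≤ Real.exp x * p k := fun k => mul_nonneg (Real.exp_pos _).le (hp0 k)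
  constructor
  · rw [sub_nonneg]
    exact sum_le_hasSum _ (fun k _ => (dJ_bounds hp0 hp j (hs0 k) hl.le).1) hA
  · have h1 : HasSum (fun k => if k ∈ S then dJ p lam j (Real.exp x * p k) else 0)
        (∑ k ∈ S, if k ∈ S then dJ p lam j (Real.exp x * p k) else 0) := by
      apply hasSum_sum_of_ne_finset_zero
      intro k hk
      simp [hk]
    have h2 : (∑ k ∈ S, if k ∈ S then dJ p lam j (Real.exp x * p k) else 0)
        = ∑ k ∈ S, dJ p lam j (Real.exp x * p k) :=
      Finset.sum_congr rfl fun k hk => by simp [hk]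
    rw [h2] at h1
    rw [sub_le_iff_le_add]
    refine hasSum_le (fun k => ?_) hA (hB.add h1)
    by_cases hk : k ∈ S
    · rw [if_pos hk]
      have := (dJ_bounds hp0 hp 0 (hs0 k) hl.le).1
      have : 0 ≤ Real.exp lam * dJ p lam 0 (Real.exp x * p k) := mul_nonneg (Real.exp_pos _).le this
      linarith
    · rw [if_neg hk, add_zero]
      have hk' : p k < Real.exp (-x) := by
        have : k ∉ AA p x := by simpa [hS] using hk
        exact not_le.1 this
      have h3 : Real.exp x * p k ≤ 1 := by
        have h4 : Real.exp x * Real.exp (-x) = 1 := by rw [← Real.exp_add]; simp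
        nlinarith [Real.exp_pos x]
      exact (dJ_bounds hp0 hp j (hs0 k) hl.le).2.trans (dJ_small p hl.le (hs0 k) h3)

lemma step {p : ℕ → ℝ} (hp0 : ∀ k, 0 ≤ p k) (hp : HasSum p 1) {lam : ℝ} (hl : 1 < lam)
    (b : ℝ) (hb : 1 ≤ b) (j : ℕ) (hj1 : 1 ≤ j) (K : ℝ) (hNt : Tendsto (NN p) atTop atTop)
    (hreg : ∀ u > 0, Tendsto (fun x => NN p (u * x) / NN p x) atTop (𝓝 (u ^ b)))
    (hH : ∃ C > 0, ∃ X > 0, ∀ y x, X ≤ y → y ≤ x → NN p y / y ≤ C * (NN p x / x))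
    (h1 : ∃ C, ∀ᶠ x in atTop, dJ p lam 1 (Real.exp x) ≤ C * (NN p x / x))
    (hK : Tendsto (fun x => dJ p lam j (Real.exp x) / (NN p x ^ j / x)) atTop (𝓝 K)) :
    Tendsto (fun x => dJ p lam (j + 1) (Real.exp x) / (NN p x ^ (j + 1) / x)) atTop
      (𝓝 (K * (Real.Gamma (j * b) * Real.Gamma (b + 1) / Real.Gamma (j * b + b)))) := by
  have hpos : ∀ᶠ x in atTop, 0 < NN p x := hNt.eventually_gt_atTop 0
  have hjb : 1 ≤ (j : ℝ) * b := by
    have : (1 : ℝ) ≤ j := by exact_mod_cast hj1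
    nlinarith
  set c : ℝ := (j : ℝ) * b - 1 with hc
  have hc0 : 0 ≤ c := by linarith
  have hL := layer_lim hp0 hp c b hc0 (by linarith) hpos hreg
  have ec : c + 1 = j * b := by rw [hc]; ring
  have ec2 : c + b + 1 = j * b + b := by rw [hc]; ring
  rw [ec, ec2] at hL
  obtain ⟨C1, hC10, hC1⟩ := step_bdd hp0 hp hl j hj1 K hNt hH hK
  obtain ⟨C, hC⟩ := h1
  set C2 := C1 + |K| with hC2
  have hC20 : 0 ≤ C2 := by positivity
  set T : ℝ → ℝ := fun x => ∑ k ∈ (AA_finite hp.summable x).toFinset, (1 + Real.log (p k) / x) ^ c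
    with hT
  have hple : ∀ k, p k ≤ 1 := fun k => le_hasSum hp k (fun i _ => hp0 i)
  suffices hdiff : Tendsto (fun x => dJ p lam (j + 1) (Real.exp x) / (NN p x ^ (j + 1) / x)
      - K * (T x / NN p x)) atTop (𝓝 0) by
    have := hdiff.add (hL.const_mul K)
    rw [zero_add] at this
    refine this.congr fun x => ?_
    simp only [hT]
    ring
  rw [Metric.tendsto_nhds]
  intro δ hδ
  -- choose ε
  obtain ⟨ε, hε0, hε1, hε⟩ : ∃ ε > 0, ε < 1 ∧ C2 * (1 - (1 - ε) ^ b) < δ / 4 := by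
    have hcont : Tendsto (fun ε : ℝ => C2 * (1 - (1 - ε) ^ b)) (𝓝 0) (𝓝 0) := by
      have h : ContinuousAt (fun ε : ℝ => C2 * (1 - (1 - ε) ^ b)) 0 := by
        have h2 : ContinuousAt (fun ε : ℝ => (1 - ε) ^ b) 0 :=
          (continuousAt_const.sub continuousAt_id).rpow_const (Or.inl (by simp))
        exact continuousAt_const.mul (continuousAt_const.sub h2)
      have h3 := h.tendsto
      simpa using h3
    have e1 : ∀ᶠ ε in 𝓝[>] (0 : ℝ), C2 * (1 - (1 - ε) ^ b) < δ / 4 :=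
      (hcont.mono_left nhdsWithin_le_nhds).eventually_lt_const (by linarith)
    have e2 : ∀ᶠ ε in 𝓝[>] (0 : ℝ), ε < 1 :=
      (gt_mem_nhds one_pos).filter_mono nhdsWithin_le_nhds
    obtain ⟨ε, ⟨h1, h2⟩, h3⟩ := ((e1.and e2).and self_mem_nhdsWithin).exists
    exact ⟨ε, h3, h2, h1⟩
  have hη := step_unif (lam := lam) hp b j K hNt hreg hK ε (δ / 4) hε0 (by linarith)
  have hlimε : ∀ᶠ x in atTop, C2 * (1 - NN p ((1 - ε) * x) / NN p x) < δ / 4 :=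
    (((hreg (1 - ε) (by linarith)).const_sub 1).const_mul C2).eventually_lt_const hε
  have hlimN : ∀ᶠ x in atTop, Real.exp lam * C / NN p x ^ j < δ / 4 := by
    have : Tendsto (fun x => Real.exp lam * C / NN p x ^ j) atTop (𝓝 0) :=
      tendsto_const_nhds.div_atTop ((tendsto_pow_atTop (by omega)).comp hNt)
    exact this.eventually_lt_const (by linarith)
  filter_upwards [hη, hlimε, hlimN, hpos, eventually_gt_atTop 0, hC1, hC]
    with x hxη hxε hxN hN0 hx0 hxC1 hxC
  set S := (AA_finite hp.summable x).toFinset with hS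
  set Q := NN p x ^ j / x with hQ
  have hQ0 : 0 < Q := by positivity
  obtain ⟨hr0, hr1⟩ := step_rest hp0 hp hl j x
  rw [← hS] at hr0 hr1
  set D := ∑ k ∈ S, dJ p lam j (Real.exp x * p k) with hD
  have eNQ : NN p x ^ (j + 1) / x = NN p x * Q := by rw [hQ]; ring
  have hterm : ∀ k ∈ S, |dJ p lam j (Real.exp x * p k) / Q - K * (1 + Real.log (p k) / x) ^ c|
      ≤ δ / 4 + (AA p x \ AA p ((1 - ε) * x)).indicator (fun _ => C2) k := by
    intro k hk
    have hkA : k ∈ AA p x := by simpa [hS] using hk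
    have hk' : Real.exp (-x) ≤ p k := hkA
    have hpk : 0 < p k := lt_of_lt_of_le (Real.exp_pos _) hk'
    set s := 1 + Real.log (p k) / x with hs
    have es : Real.exp x * p k = Real.exp (s * x) := by
      have : s * x = x + Real.log (p k) := by rw [hs]; field_simp
      rw [this, Real.exp_add, Real.exp_log hpk]
    have hlog : Real.log (p k) ≤ 0 := Real.log_nonpos (hp0 k) (hple k)
    have hs1 : s ≤ 1 := by
      have : Real.log (p k) / x ≤ 0 := div_nonpos_of_nonpos_of_nonneg hlog hx0.le
      linarith
    have hs0 : 0 ≤ s := by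
      have h1 := (Real.le_log_iff_exp_le hpk).2 hk'
      have : -1 ≤ Real.log (p k) / x := by rw [le_div_iff₀ hx0]; linarith
      linarith
    have hind0 : 0 ≤ (AA p x \ AA p ((1 - ε) * x)).indicator (fun _ => C2) k :=
      Set.indicator_nonneg (fun _ _ => hC20) _
    rw [es]
    by_cases hsε : ε ≤ s
    · have := hxη s ⟨hsε, hs1⟩
      linarith
    · push Not at hsε
      have hnot : k ∉ AA p ((1 - ε) * x) := by
        intro hk2
        have hk3 : Real.exp (-((1 - ε) * x)) ≤ p k := hk2
        have h1 := (Real.le_log_iff_exp_le hpk).2 hk3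
        have : -(1 - ε) ≤ Real.log (p k) / x := by rw [le_div_iff₀ hx0]; linarith
        linarith
      rw [Set.indicator_of_mem (show k ∈ AA p x \ AA p ((1 - ε) * x) from ⟨hkA, hnot⟩)]
      have h1 := hxC1 (s * x) (by nlinarith)
      have h2 := (dJ_bounds hp0 hp j (Real.exp_pos (s * x)).le hl.le).1
      have h3 : dJ p lam j (Real.exp (s * x)) / Q ≤ C1 := by rw [div_le_iff₀ hQ0]; exact h1
      have h4 : 0 ≤ dJ p lam j (Real.exp (s * x)) / Q := div_nonneg h2 hQ0.le
      have h5 : |K * s ^ c| ≤ |K| := by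
        rw [abs_mul, abs_of_nonneg (Real.rpow_nonneg hs0 c)]
        exact mul_le_of_le_one_right (abs_nonneg _) (Real.rpow_le_one hs0 hs1 hc0)
      rw [abs_le] at h5
      have h6 := h5.1
      have h7 := h5.2
      rw [abs_le]
      constructor <;> linarith
  have hcard : (S.card : ℝ) = NN p x := by
    rw [hS, ← Set.ncard_eq_toFinset_card _ (AA_finite hp.summable x)]; rfl
  have hsum : |D / Q - K * T x| ≤ δ / 4 * NN p x + C2 * (NN p x - NN p ((1 - ε) * x)) := by
    have e : D / Q - K * T x = ∑ k ∈ S, (dJ p lam j (Real.exp x * p k) / Q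
        - K * (1 + Real.log (p k) / x) ^ c) := by
      rw [Finset.sum_sub_distrib, hD, hT, Finset.sum_div, Finset.mul_sum]
    rw [e]
    refine (Finset.abs_sum_le_sum_abs _ _).trans ((Finset.sum_le_sum hterm).trans ?_)
    rw [Finset.sum_add_distrib, Finset.sum_const, nsmul_eq_mul, hcard, mul_comm (NN p x)]
    have h1 := card_diff_hasSum (p := p) hp.summable
      (show (1 - ε) * x ≤ x by nlinarith) C2
    have h2 := sum_le_hasSum S (fun k _ => Set.indicator_nonneg (fun _ _ => hC20) _) h1
    rw [mul_comm C2]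
    linarith
  have hrest : (dJ p lam (j + 1) (Real.exp x) - D) / (NN p x * Q) < δ / 4 := by
    refine lt_of_le_of_lt ?_ hxN
    rw [div_le_iff₀ (by positivity)]
    refine hr1.trans ?_
    have h2 := mul_le_mul_of_nonneg_left hxC (Real.exp_pos lam).le
    refine h2.trans (le_of_eq ?_)
    rw [hQ]
    field_simp
  have hrest0 : 0 ≤ (dJ p lam (j + 1) (Real.exp x) - D) / (NN p x * Q) :=
    div_nonneg hr0 (by positivity)
  have hmain : |(D / Q - K * T x) / NN p x| < δ / 2 := by
    rw [abs_div, abs_of_pos hN0, div_lt_iff₀ hN0]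
    refine lt_of_le_of_lt hsum ?_
    have : C2 * (1 - NN p ((1 - ε) * x) / NN p x) * NN p x
        = C2 * (NN p x - NN p ((1 - ε) * x)) := by field_simp
    nlinarith [mul_lt_mul_of_pos_right hxε hN0]
  have efin : dJ p lam (j + 1) (Real.exp x) / (NN p x ^ (j + 1) / x) - K * (T x / NN p x)
      = (D / Q - K * T x) / NN p x + (dJ p lam (j + 1) (Real.exp x) - D) / (NN p x * Q) := by
    rw [eNQ]
    field_simp
    ring
  rw [Real.dist_eq, sub_zero, efin]
  rw [abs_lt] at hmain ⊢
  constructor <;> linarith [hmain.1, hmain.2]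

lemma NN_ratio {p : ℕ → ℝ} {V : ℝ → ℝ}
    (hV : ∀ a, Tendsto (fun x => (NN p (x + a) - NN p x) / V x) atTop (𝓝 a)) (w h : ℝ) :
    Tendsto (fun x => (NN p (x + w + h) - NN p (x + w)) / (NN p (x + 1) - NN p x))
      atTop (𝓝 h) := by
  have h1 := ((hV (w + h)).sub (hV w)).div (hV 1) one_ne_zero
  have e : (w + h - w) / 1 = h := by ring
  rw [e] at h1
  have hVne : ∀ᶠ x in atTop, V x ≠ 0 := by
    have := (hV 1).eventually_ne one_ne_zero
    filter_upwards [this] with x hx h0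
    rw [h0, div_zero] at hx
    exact hx rfl
  refine h1.congr' ?_
  filter_upwards [hVne] with x hx
  simp only [Pi.div_apply]
  rw [← sub_div, div_div_div_cancel_right₀ hx, ← add_assoc]
  congr 1
  ring

lemma NN_int {p : ℕ → ℝ} (hs : Summable p) {x : ℝ} (h : 0 < NN p (x + 1) - NN p x) :
    1 ≤ NN p (x + 1) - NN p x := by
  unfold NN at *
  have h1 : (AA p x).ncard < (AA p (x + 1)).ncard := by
    have := sub_pos.1 h
    exact_mod_cast this
  have h2 : (AA p x).ncard + 1 ≤ (AA p (x + 1)).ncard := h1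
  have h3 : ((AA p x).ncard : ℝ) + 1 ≤ (AA p (x + 1)).ncard := by exact_mod_cast h2
  linarith

lemma gen_lim {p : ℕ → ℝ} (hp0 : ∀ k, 0 ≤ p k) (hp : HasSum p 1) {lam : ℝ} (hl : 1 < lam)
    (b : ℝ) (hb : 1 ≤ b) (hNt : Tendsto (NN p) atTop atTop)
    (hreg : ∀ u > 0, Tendsto (fun x => NN p (u * x) / NN p x) atTop (𝓝 (u ^ b)))
    (hH : ∃ C > 0, ∃ X > 0, ∀ y x, X ≤ y → y ≤ x → NN p y / y ≤ C * (NN p x / x))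
    (h1 : Tendsto (fun x => dJ p lam 1 (Real.exp x) / (NN p x / x)) atTop
      (𝓝 (b * Real.log lam))) (j : ℕ) (hj : 1 ≤ j) :
    Tendsto (fun x => dJ p lam j (Real.exp x) / (NN p x ^ j / x)) atTop
      (𝓝 (Real.log lam * (Real.Gamma (b + 1) ^ j / Real.Gamma (j * b)))) := by
  have hb0 : 0 < b := by linarith
  have hbd : ∃ C, ∀ᶠ x in atTop, dJ p lam 1 (Real.exp x) ≤ C * (NN p x / x) := by
    refine ⟨b * Real.log lam + 1, ?_⟩
    filter_upwards [h1.eventually_lt_const (show _ < b * Real.log lam + 1 by linarith),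
      hNt.eventually_gt_atTop 0, eventually_gt_atTop 0] with x hx hN hx0
    rw [div_lt_iff₀ (by positivity)] at hx
    exact hx.le
  induction j, hj using Nat.le_induction with
  | base =>
    simp only [pow_one, Nat.cast_one, one_mul]
    have hg := (Real.Gamma_pos_of_pos hb0).ne'
    rw [Real.Gamma_add_one hb0.ne', mul_div_assoc, div_self hg, mul_one, mul_comm]
    exact h1
  | succ j hj ih =>
    have := step hp0 hp hl b hb j hj _ hNt hreg hH hbd ih
    convert this using 2
    have hj0 : (0 : ℝ) < j := by exact_mod_cast hj
    have hg := (Real.Gamma_pos_of_pos (mul_pos hj0 hb0)).ne'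
    have e : ((j + 1 : ℕ) : ℝ) * b = j * b + b := by push_cast; ring
    rw [e, pow_succ]
    field_simp

lemma shift_lim {N : ℝ → ℝ} (hN : Monotone N) (b : ℝ) (hNt : Tendsto N atTop atTop)
    (hreg : ∀ u > 0, Tendsto (fun x => N (u * x) / N x) atTop (𝓝 (u ^ b))) (h : ℝ) :
    Tendsto (fun x => N (x + h) / N x) atTop (𝓝 1) := by
  have h1 := N_cont N hN b (hNt.eventually_gt_atTop 0) hreg 1 one_pos
  rw [Real.one_rpow] at h1
  have h2 : Tendsto (fun x : ℝ => (x, 1 + h / x)) atTop (atTop ×ˢ 𝓝 1) := by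
    refine tendsto_id.prodMk ?_
    have := (tendsto_const_nhds (x := h)).div_atTop (tendsto_id (α := ℝ) (x := atTop))
    simpa using this.const_add 1
  refine (h1.comp h2).congr' ?_
  filter_upwards [eventually_gt_atTop 0] with x hx
  simp only [Function.comp]
  congr 2
  field_simp

lemma inv_lim {p : ℕ → ℝ} (hp : HasSum p 1) {lam : ℝ} (hl0 : 0 < lam)
    (b : ℝ) (hNt : Tendsto (NN p) atTop atTop)
    (hreg : ∀ u > 0, Tendsto (fun x => NN p (u * x) / NN p x) atTop (𝓝 (u ^ b)))
    (j : ℕ) (K : ℝ)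
    (hK : Tendsto (fun x => dJ p lam⁻¹ j (Real.exp x) / (NN p x ^ j / x)) atTop (𝓝 K)) :
    Tendsto (fun x => dJ p lam j (Real.exp x) / (NN p x ^ j / x)) atTop (𝓝 (-K)) := by
  set h := Real.log lam with hh
  have hsh := shift_lim (NN_mono hp.summable) b hNt hreg h
  have ht : Tendsto (fun x : ℝ => x + h) atTop atTop := tendsto_atTop_add_const_right _ _ tendsto_id
  have hx : Tendsto (fun x : ℝ => x / (x + h)) atTop (𝓝 1) := by
    have h3 : Tendsto (fun x : ℝ => 1 - h / (x + h)) atTop (𝓝 (1 - 0)) :=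
      ((tendsto_const_nhds (x := h)).div_atTop ht).const_sub 1
    rw [sub_zero] at h3
    refine h3.congr' ?_
    filter_upwards [ht.eventually_gt_atTop 0] with x hx
    field_simp
    ring
  have h4 := (((hK.comp ht).mul (hsh.pow j)).mul hx).neg
  simp only [one_pow, mul_one] at h4
  refine h4.congr' ?_
  filter_upwards [eventually_gt_atTop 0, ht.eventually_gt_atTop 0, hNt.eventually_gt_atTop 0,
    (hNt.comp ht).eventually_gt_atTop 0] with x h1 h2 h3 h5
  simp only [Function.comp] at h5 ⊢
  have e : dJ p lam j (Real.exp x) = - dJ p lam⁻¹ j (Real.exp (x + h)) := by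
    unfold dJ
    have e1 : Real.exp (x + h) = lam * Real.exp x := by
      rw [Real.exp_add, hh, Real.exp_log hl0]; ring
    rw [e1, inv_mul_cancel_left₀ hl0.ne']
    ring
  rw [e, div_pow]
  field_simp

theorem stmt2
    (p : ℕ → ℝ) (hp0 : ∀ k, 0 ≤ p k) (hp1 : ∑' k, p k = 1)
    (hpinf : {k | 0 < p k}.Infinite)
    (β : ℝ) (hβ : 0 ≤ β)
    (ℓ : ℝ → ℝ) (hℓpos : ∀ x > 0, 0 < ℓ x)
    (hℓsv : ∀ c > 0, Tendsto (fun x => ℓ (c * x) / ℓ x) atTop (𝓝 1))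
    (h6 : ∀ lam > 0, Tendsto
      (fun t => (rhoJ p 1 (lam * t) - rhoJ p 1 t) / (Real.log t ^ β * ℓ (Real.log t)))
      atTop (𝓝 (Real.log lam)))
    (h60 : β = 0 → (∃ x₀, MonotoneOn ℓ (Set.Ici x₀)) ∧ Tendsto ℓ atTop atTop)
    (j : ℕ) (hj : 1 ≤ j) (lam : ℝ) (hlam : 0 < lam) :
    Tendsto
      (fun t => (PhiJ p j (lam * t) - PhiJ p j t) /
        (Real.log t ^ ((j : ℝ) * β + j - 1) * (ℓ (Real.log t)) ^ j))
      atTop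
      (𝓝 ((Real.Gamma (β + 1)) ^ j / Real.Gamma (j * (β + 1)) * Real.log lam)) := by
  have hp : HasSum p 1 := by
    have hs : Summable p := by
      by_contra h
      rw [tsum_eq_zero_of_not_summable h] at hp1
      exact zero_ne_one hp1
    rw [← hp1]
    exact hs.hasSum
  have hmono := NN_mono hp.summable
  set V : ℝ → ℝ := fun x => x ^ β * ℓ x with hVdef
  have hVpos : ∀ x > 0, 0 < V x := fun x hx => mul_pos (Real.rpow_pos_of_pos hx β) (hℓpos x hx)
  have hV : ∀ a, Tendsto (fun x => (NN p (x + a) - NN p x) / V x) atTop (𝓝 a) := by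
    intro a
    have h := (h6 (Real.exp a) (Real.exp_pos a)).comp Real.tendsto_exp_atTop
    rw [Real.log_exp] at h
    refine h.congr fun x => ?_
    simp only [Function.comp]
    rw [rhoJ_one _ _ (by positivity), rhoJ_one _ _ (by positivity), Real.log_exp, ← Real.exp_add,
      Real.log_exp, add_comm a x]
  set U : ℝ → ℝ := fun x => NN p (x + 1) - NN p x with hUdef
  have hUV : Tendsto (fun x => U x / V x) atTop (𝓝 1) := hV 1
  have hU1 : ∀ᶠ x in atTop, 1 ≤ NN p (x + 1) - NN p x := by
    filter_upwards [hUV.eventually_const_lt one_pos, eventually_gt_atTop 0] with x hx hx0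
    exact NN_int hp.summable ((div_pos_iff_of_pos_right (hVpos x hx0)).1 hx)
  have hUreg : ∀ c > 0, Tendsto (fun x => (NN p (c * x + 1) - NN p (c * x)) /
      (NN p (x + 1) - NN p x)) atTop (𝓝 (c ^ β)) := by
    intro c hc
    have hcx : Tendsto (fun x : ℝ => c * x) atTop atTop := tendsto_id.const_mul_atTop hc
    have h1 := (((hUV.comp hcx).mul (hℓsv c hc)).div hUV one_ne_zero).mul_const (c ^ β)
    have e : 1 * 1 / 1 * c ^ β = c ^ β := by ring
    rw [e] at h1
    refine h1.congr' ?_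
    filter_upwards [eventually_gt_atTop 0, hU1] with x hx hu
    have a1 := (hVpos x hx).ne'
    have a3 := (hℓpos x hx).ne'
    have a4 := (hℓpos (c * x) (by positivity)).ne'
    have a5 := (Real.rpow_pos_of_pos hx β).ne'
    have a6 := (Real.rpow_pos_of_pos hc β).ne'
    have hu' : NN p (x + 1) - NN p x ≠ 0 := by linarith
    simp only [Function.comp, Pi.div_apply, hVdef, hUdef]
    rw [Real.mul_rpow hc.le hx.le]
    field_simp
  have hKar := karamata (NN p) hmono β hβ (NN_nonneg p) hU1 hUreg
  have hb0 : 0 < β + 1 := by linarith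
  have hNt : Tendsto (NN p) atTop atTop := by
    have h1 : ∀ᶠ x in atTop, 1 / (β + 1) / 2 * x ≤ NN p x := by
      have hlt : 1 / (β + 1) / 2 < 1 / (β + 1) := half_lt_self (by positivity)
      filter_upwards [hKar.eventually_const_lt hlt, hU1, eventually_gt_atTop 0] with x hx hu hx0
      have hu0 : 0 < NN p (x + 1) - NN p x := by linarith
      rw [lt_div_iff₀ (mul_pos hx0 hu0)] at hx
      have h2 : x ≤ x * (NN p (x + 1) - NN p x) := le_mul_of_one_le_right hx0.le hu
      have h3 : (0 : ℝ) ≤ 1 / (β + 1) / 2 := by positivity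
      exact (mul_le_mul_of_nonneg_left h2 h3).trans hx.le
    exact tendsto_atTop_mono' _ h1 (tendsto_id.const_mul_atTop (by positivity))
  have hreg := N_reg (NN p) β hU1 hβ hUreg hKar
  have hNpos : ∀ᶠ x in atTop, 0 < NN p x := hNt.eventually_gt_atTop 0
  have hNV : Tendsto (fun x => NN p x / (x * V x)) atTop (𝓝 (1 / (β + 1))) := by
    have h1 := hKar.mul hUV
    rw [mul_one] at h1
    refine h1.congr' ?_
    filter_upwards [hU1, eventually_gt_atTop 0] with x hu hx0
    have hu' : NN p (x + 1) - NN p x ≠ 0 := by linarith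
    have a1 := (hVpos x hx0).ne'
    simp only [hUdef]
    field_simp
  have hH : ∃ C > 0, ∃ X > 0, ∀ y x, X ≤ y → y ≤ x → NN p y / y ≤ C * (NN p x / x) := by
    rcases hβ.lt_or_eq with hβ0 | hβ0
    · obtain ⟨X, hX, h⟩ := N_almost (NN p) hmono β hβ0 hNpos hreg
      exact ⟨2, two_pos, X, hX, h⟩
    · obtain ⟨⟨x₀, hx₀⟩, -⟩ := h60 hβ0.symm
      have e : ∀ x, V x = ℓ x := fun x => by simp [hVdef, ← hβ0]
      have h1 : Tendsto (fun x => NN p x / (x * ℓ x)) atTop (𝓝 1) := by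
        have := hNV
        rw [← hβ0] at this
        simp only [e] at this
        simpa using this
      obtain ⟨X, hX⟩ := eventually_atTop.1 (((h1.eventually_lt_const (show (1 : ℝ) < 2 by norm_num)).and
        (h1.eventually_const_lt (show (1 / 2 : ℝ) < 1 by norm_num))).and
        ((eventually_gt_atTop 0).and (eventually_ge_atTop x₀)))
      refine ⟨4, by norm_num, X, (hX X le_rfl).2.1, fun y x hy hyx => ?_⟩
      have hy1 := hX y hy
      have hx1 := hX x (hy.trans hyx)
      have hℓ := hx₀ hy1.2.2 hx1.2.2 hyx
      have ly := hℓpos y hy1.2.1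
      have lx := hℓpos x hx1.2.1
      have b1 := hy1.1.1
      have b2 := hx1.1.2
      rw [← div_div, div_lt_iff₀ ly] at b1
      rw [← div_div, lt_div_iff₀ lx] at b2
      linarith
  have hmain1 : ∀ lam > 1, Tendsto (fun x => dJ p lam j (Real.exp x) / (NN p x ^ j / x)) atTop
      (𝓝 (Real.log lam * (Real.Gamma (β + 1 + 1) ^ j / Real.Gamma (j * (β + 1))))) := by
    intro lam hl
    have hr := fun w h => NN_ratio hV w h
    refine gen_lim hp0 hp hl (β + 1) (by linarith) hNt hreg hH ?_ j hj
    have hsh : Tendsto (fun x => (NN p (x + 1 + 1) - NN p (x + 1)) / (NN p (x + 1) - NN p x))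
        atTop (𝓝 1) := hr 1 1
    have hh : ∃ C, ∀ᶠ x in atTop, NN p (x + Real.log lam) - NN p x ≤ C * (NN p (x + 1) - NN p x) := by
      refine ⟨Real.log lam + 1, ?_⟩
      have h1 := hr 0 (Real.log lam)
      simp only [add_zero] at h1
      filter_upwards [h1.eventually_lt_const (show _ < Real.log lam + 1 by linarith), hU1]
        with x hx hu
      rw [div_lt_iff₀ (by linarith)] at hx
      exact hx.le
    have hg := growth (NN p) hmono (NN_nonneg p) (Real.log lam) hU1 hsh hh
    have hbase := base_case hp0 hp hl (fun w => by
      simpa [sub_eq_add_neg] using hr (-w) (Real.log lam)) hU1 hg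
    have h2 := hbase.div hKar (by positivity)
    have e : Real.log lam / (1 / (β + 1)) = (β + 1) * Real.log lam := by field_simp
    rw [e] at h2
    refine h2.congr' ?_
    filter_upwards [hU1, eventually_gt_atTop 0, hNpos] with x hu hx0 hN0
    have hu' : NN p (x + 1) - NN p x ≠ 0 := by linarith
    simp only [Pi.div_apply]
    field_simp
  have hmain : Tendsto (fun x => dJ p lam j (Real.exp x) / (NN p x ^ j / x)) atTop
      (𝓝 (Real.log lam * (Real.Gamma (β + 1 + 1) ^ j / Real.Gamma (j * (β + 1))))) := by
    rcases lt_trichotomy lam 1 with h | h | h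
    · have h1 := inv_lim hp hlam (β + 1) hNt hreg j _ (hmain1 lam⁻¹ ((one_lt_inv₀ hlam).2 h))
      rw [Real.log_inv] at h1
      convert h1 using 2
      ring
    · subst h
      simp [dJ]
    · exact hmain1 lam h
  have hfin := (hmain.mul (hNV.pow j)).comp Real.tendsto_log_atTop
  have e : Real.log lam * (Real.Gamma (β + 1 + 1) ^ j / Real.Gamma (j * (β + 1))) *
      (1 / (β + 1)) ^ j
      = (Real.Gamma (β + 1)) ^ j / Real.Gamma (j * (β + 1)) * Real.log lam := by
    rw [Real.Gamma_add_one hb0.ne', mul_pow, div_pow, one_pow]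
    field_simp
  rw [e] at hfin
  refine hfin.congr' ?_
  filter_upwards [eventually_gt_atTop 0, Real.tendsto_log_atTop.eventually hNpos,
    Real.tendsto_log_atTop.eventually_gt_atTop 0] with t ht hN0 hx0
  simp only [Function.comp]
  rw [Real.exp_log ht]
  set x := Real.log t with hx
  have e1 : x ^ ((j : ℝ) * β + j - 1) = (x ^ β) ^ j * x ^ j / x := by
    rw [Real.rpow_sub hx0, Real.rpow_one, Real.rpow_add hx0, Real.rpow_natCast,
      mul_comm (j : ℝ) β, Real.rpow_mul hx0.le, Real.rpow_natCast]
  have a1 := (Real.rpow_pos_of_pos hx0 β).ne'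
  have a2 := (hℓpos x hx0).ne'
  rw [e1]
  simp only [hVdef, dJ, div_pow, mul_pow]
  field_simp
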